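/- (Improved Prevalent Dynamics) Let (X,C) be a strongly ordered separable Banach space and F₀ : X → X a compact C¹ map with DF₀(x) strongly positive for every x; assume F₀ is pointwise dissipative with attractor A. Then there is an integer m > 0 such that the set Q₀ := {x ∈ X : ω(x,F₀) is a linearly stable cycle of F₀ of minimal period at most m} is Borel and prevalent in X. -/

import Mathlib

open Filter Topology MeasureTheory Set Bornology Metric
open scoped ENNReal NNReal

noncomputable section

section Defs

variable {X : Type*} [NormedAddCommGroup X] [NormedSpace ℝ X]

/-- A cone in a Banach space: a closed convex set with `r • C ⊆ C` for all `r > 0`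
and `C ∩ (-C) = {0}`. -/
def IsCone (C : Set X) : Prop :=
  IsClosed C ∧ Convex ℝ C ∧ (∀ r : ℝ, 0 < r → ∀ x ∈ C, r • x ∈ C) ∧ C ∩ (-C) = {0}

/-- `(X, C)` is strongly ordered: `C` is a cone with nonempty interior. -/
def StronglyOrderedCone (C : Set X) : Prop :=
  IsCone C ∧ (interior C).Nonempty

/-- `x < y` in the order induced by the cone `C`. -/
def coneLT (C : Set X) (x y : X) : Prop := y - x ∈ C \ {0}

/-- `x ≤ y` in the order induced by the cone `C`. -/
def coneLE (C : Set X) (x y : X) : Prop := y - x ∈ C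

/-- `x ≪ y` in the order induced by the cone `C`. -/
def coneLLT (C : Set X) (x y : X) : Prop := y - x ∈ interior C

/-- A bounded linear operator is strongly positive (w.r.t. the cone `C`) if
`T v ≫ 0` whenever `v > 0`. -/
def StronglyPositive (C : Set X) (T : X →L[ℝ] X) : Prop :=
  ∀ v : X, v ∈ C \ {0} → T v ∈ interior C

/-- A map between normed spaces is compact if it sends bounded sets to relatively
compact sets. -/
def IsCompactMap {Y Z : Type*} [NormedAddCommGroup Y] [NormedAddCommGroup Z]
    (f : Y → Z) : Prop :=
  ∀ B : Set Y, IsBounded B → IsCompact (closure (f '' B))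

/-- `h` is pointwise dissipative: some nonempty bounded set `B` attracts every point. -/
def PointwiseDissipative (h : X → X) : Prop :=
  ∃ B : Set X, B.Nonempty ∧ IsBounded B ∧
    ∀ x : X, Tendsto (fun n : ℕ => infDist (h^[n] x) B) atTop (nhds 0)

/-- The set `A` attracts the set `B` under iteration of `h`. -/
def AttractsSet (h : X → X) (A B : Set X) : Prop :=
  ∀ ε : ℝ, 0 < ε → ∃ N : ℕ, ∀ n : ℕ, N ≤ n → ∀ x ∈ B, infDist (h^[n] x) A < ε

/-- `A` is an attractor of `h`: the maximal compact invariant set attracting every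
bounded set. -/
def IsAttractor (h : X → X) (A : Set X) : Prop :=
  A.Nonempty ∧ IsCompact A ∧ h '' A = A ∧
    (∀ B : Set X, IsBounded B → AttractsSet h A B) ∧
    (∀ A' : Set X, IsCompact A' → h '' A' = A' → A' ⊆ A)

/-- The ω-limit set `ω(x,h) = ⋂ₖ closure {hⁿ x : n ≥ k}`. -/
def omegaMap (h : X → X) (x : X) : Set X :=
  ⋂ k : ℕ, closure {y : X | ∃ n : ℕ, k ≤ n ∧ y = h^[n] x}

/-- The largest Lyapunov exponent `λ_max(x,h) = liminf (log ‖Dhⁿ(x)‖)/n` (in `EReal`). -/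
def lambdaMax (h : X → X) (x : X) : EReal :=
  atTop.liminf fun n : ℕ => ((Real.log ‖fderiv ℝ (h^[n]) x‖ / n : ℝ) : EReal)

/-- The principal Lyapunov exponent `λ₁(x,h) = limsup (log ‖Dhⁿ(x)‖)/n` (in `EReal`). -/
def lambdaOne (h : X → X) (x : X) : EReal :=
  atTop.limsup fun n : ℕ => ((Real.log ‖fderiv ℝ (h^[n]) x‖ / n : ℝ) : EReal)

/-- `S` is a linearly stable cycle of `h` of minimal period `p`: `S` is the orbit of a
`p`-periodic point `z` with spectral radius of `Dhᵖ(z)` at most `1`. -/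
def IsLinStableCycle (h : X → X) (p : ℕ) (S : Set X) : Prop :=
  ∃ z : X, h^[p] z = z ∧ (∀ l : ℕ, 0 < l → l < p → h^[l] z ≠ z) ∧
    spectralRadius ℝ (fderiv ℝ (h^[p]) z) ≤ 1 ∧ S = {y : X | ∃ n : ℕ, y = h^[n] z}

/-- `S` is a linearly stable cycle of `h` of minimal period at most `m`. -/
def IsLinStableCycleLe (h : X → X) (m : ℕ) (S : Set X) : Prop :=
  ∃ p : ℕ, 0 < p ∧ p ≤ m ∧ IsLinStableCycle h p S

/-- Semiflow axioms for `Φ : ℝ → X → X` (restricted to nonnegative times). -/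
def IsSemiflow (Φ : ℝ → X → X) : Prop :=
  (∀ x : X, Φ 0 x = x) ∧
    (∀ s t : ℝ, 0 ≤ s → 0 ≤ t → ∀ x : X, Φ (t + s) x = Φ t (Φ s x)) ∧
    ContinuousOn (fun p : ℝ × X => Φ p.1 p.2) (Ici (0 : ℝ) ×ˢ (univ : Set X))

/-- The ω-limit set of `x` under a semiflow. -/
def omegaFlow (Φ : ℝ → X → X) (x : X) : Set X :=
  ⋂ s : ℝ, closure {y : X | ∃ t : ℝ, s ≤ t ∧ y = Φ t x}

/-- The largest Lyapunov exponent of `x` w.r.t. a semiflow. -/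
def lambdaMaxFlow (Φ : ℝ → X → X) (x : X) : EReal :=
  atTop.liminf fun t : ℝ => ((Real.log ‖fderiv ℝ (Φ t) x‖ / t : ℝ) : EReal)

/-- The principal Lyapunov exponent of `x` w.r.t. a semiflow. -/
def lambdaOneFlow (Φ : ℝ → X → X) (x : X) : EReal :=
  atTop.limsup fun t : ℝ => ((Real.log ‖fderiv ℝ (Φ t) x‖ / t : ℝ) : EReal)

end Defs

section Shy

variable {X : Type*} [NormedAddCommGroup X] [NormedSpace ℝ X] [MeasurableSpace X]

/-- A Borel set `W` is shy if there is a nonzero compactly supported Borel measure `μ`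
with `μ(x + W) = 0` for every `x`. -/
def IsShy (W : Set X) : Prop :=
  MeasurableSet W ∧
    ∃ μ : Measure X, μ ≠ 0 ∧ (∃ K : Set X, IsCompact K ∧ μ Kᶜ = 0) ∧
      ∀ x : X, μ ((fun w => x + w) '' W) = 0

/-- `W` is prevalent in `V` if `V \ W` is shy. -/
def IsPrevalentIn (V W : Set X) : Prop := IsShy (V \ W)

end Shy

section PositiveOperators

variable {X : Type*} [NormedAddCommGroup X] [NormedSpace ℝ X]

/-- A closed pointed convex cone `C` with an order unit `e` and a positive functional `φ`
normalized by `φ e = 1`; every `w` satisfies `-(c * ‖w‖) • e ≤ w`. -/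
structure IsUnitCone (C : Set X) (e : X) (φ : X →L[ℝ] ℝ) (c : ℝ) : Prop where
  isClosed : IsClosed C
  zero_mem : (0 : X) ∈ C
  add_mem : ∀ x ∈ C, ∀ y ∈ C, x + y ∈ C
  smul_mem : ∀ r : ℝ, 0 ≤ r → ∀ x ∈ C, r • x ∈ C
  pointed : ∀ x ∈ C, -x ∈ C → x = 0
  c_pos : 0 < c
  unit : ∀ w : X, (c * ‖w‖) • e + w ∈ C
  unit_mem : e ∈ interior C
  map_nonneg : ∀ x ∈ C, 0 ≤ φ x
  map_unit : φ e = 1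

/-- A family of bounded positive operators with uniform lower bounds in terms of the
order unit `e`. -/
structure IsHarnackFamily (C : Set X) (e : X) (𝓑 : Set (X →L[ℝ] X)) (a L : ℝ) : Prop where
  a_pos : 0 < a
  a_le_one : a ≤ 1
  one_le : 1 ≤ L
  pos : ∀ B ∈ 𝓑, ∀ x ∈ C, B x ∈ C
  lower : ∀ B ∈ 𝓑, B e - a • e ∈ C
  norm_le : ∀ B ∈ 𝓑, ‖B‖ ≤ L
  harnack : ∀ η : ℝ, 0 < η → ∃ δ : ℝ, 0 < δ ∧ ∀ B ∈ 𝓑, ∀ B' ∈ 𝓑, ∀ z ∈ C,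
    η * ‖z‖ ≤ ‖B z‖ → B' (B z) - (δ * ‖B z‖) • e ∈ C

/-- The product `B (n - 1) ∘ ⋯ ∘ B 0`. -/
def prodSeq (B : ℕ → X →L[ℝ] X) : ℕ → (X →L[ℝ] X)
  | 0 => ContinuousLinearMap.id ℝ X
  | n + 1 => (prodSeq (fun i => B (i + 1)) n).comp (B 0)

@[simp] lemma prodSeq_zero (B : ℕ → X →L[ℝ] X) (x : X) : prodSeq B 0 x = x := rfl

lemma prodSeq_succ (B : ℕ → X →L[ℝ] X) (n : ℕ) (x : X) :
    prodSeq B (n + 1) x = prodSeq (fun i => B (i + 1)) n (B 0 x) := rfl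

lemma prodSeq_add (B : ℕ → X →L[ℝ] X) (m n : ℕ) (x : X) :
    prodSeq B (m + n) x = prodSeq (fun i => B (m + i)) n (prodSeq B m x) := by
  induction m generalizing B x with
  | zero => simp
  | succ m ih =>
    rw [show m + 1 + n = (m + n) + 1 by omega, prodSeq_succ, ih, prodSeq_succ]
    congr 2
    ext i : 1
    congr 1
    omega

lemma prodSeq_succ_apply (B : ℕ → X →L[ℝ] X) (n : ℕ) (x : X) :
    prodSeq B (n + 1) x = B n (prodSeq B n x) := by
  rw [prodSeq_add]; rfl

variable {C : Set X} {e : X} {φ : X →L[ℝ] ℝ} {c a L : ℝ} {𝓑 : Set (X →L[ℝ] X)}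

lemma map_le_map_of_sub_mem {ℓ : X →L[ℝ] ℝ} (hℓ : ∀ x ∈ C, 0 ≤ ℓ x) {x y : X} (h : y - x ∈ C) :
    ℓ x ≤ ℓ y := by
  have := hℓ _ h
  rw [map_sub] at this
  linarith

namespace IsUnitCone

variable (hC : IsUnitCone C e φ c)
include hC

lemma mem_e : e ∈ C := interior_subset hC.unit_mem

lemma unit_sub (w : X) : (c * ‖w‖) • e - w ∈ C := by
  have := hC.unit (-w)
  rwa [norm_neg, ← sub_eq_add_neg] at this

lemma le_unit {ℓ : X →L[ℝ] ℝ} (hℓ : ∀ x ∈ C, 0 ≤ ℓ x) (w : X) : ℓ w ≤ c * ‖w‖ * ℓ e := by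
  have := map_le_map_of_sub_mem hℓ (hC.unit_sub w)
  simpa using this

lemma neg_unit_le {ℓ : X →L[ℝ] ℝ} (hℓ : ∀ x ∈ C, 0 ≤ ℓ x) (w : X) :
    -(c * ‖w‖ * ℓ e) ≤ ℓ w := by
  have := hC.le_unit hℓ (-w)
  rw [norm_neg, map_neg] at this
  linarith

end IsUnitCone

variable (hC : IsUnitCone C e φ c) (hF : IsHarnackFamily C e 𝓑 a L)
include hF

lemma prodSeq_mem {B : ℕ → X →L[ℝ] X} (hB : ∀ i, B i ∈ 𝓑) (n : ℕ) {x : X} (hx : x ∈ C) :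
    prodSeq B n x ∈ C := by
  induction n with
  | zero => simpa
  | succ n ih => rw [prodSeq_succ_apply]; exact hF.pos _ (hB n) _ ih

lemma prodSeq_norm_le {B : ℕ → X →L[ℝ] X} (hB : ∀ i, B i ∈ 𝓑) (n : ℕ) (x : X) :
    ‖prodSeq B n x‖ ≤ L ^ n * ‖x‖ := by
  induction n with
  | zero => simp
  | succ n ih =>
    rw [prodSeq_succ_apply]
    have hL := hF.one_le
    calc _ ≤ ‖B n‖ * ‖prodSeq B n x‖ := (B n).le_opNorm _
      _ ≤ L * (L ^ n * ‖x‖) := by gcongr; exact hF.norm_le _ (hB n)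
      _ = _ := by ring

include hC

lemma prodSeq_functional_nonneg {B : ℕ → X →L[ℝ] X} (hB : ∀ i, B i ∈ 𝓑) (n : ℕ) :
    ∀ x ∈ C, 0 ≤ (φ.comp (prodSeq B n)) x := fun _ hx =>
  hC.map_nonneg _ (prodSeq_mem hF hB n hx)

lemma prodSeq_lower {B : ℕ → X →L[ℝ] X} (hB : ∀ i, B i ∈ 𝓑) (n : ℕ) :
    prodSeq B n e - a ^ n • e ∈ C := by
  induction n with
  | zero => simpa using hC.zero_mem
  | succ n ih =>
    rw [prodSeq_succ_apply]
    have h1 := hF.pos _ (hB n) _ ih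
    have h2 := hC.smul_mem (a ^ n) (pow_nonneg hF.a_pos.le n) _ (hF.lower _ (hB n))
    have h3 := hC.add_mem _ h1 _ h2
    convert h3 using 1
    rw [map_sub, map_smul, pow_succ]
    module

lemma prodSeq_functional_lower {B : ℕ → X →L[ℝ] X} (hB : ∀ i, B i ∈ 𝓑) (n : ℕ) :
    a ^ n ≤ φ (prodSeq B n e) := by
  have := map_le_map_of_sub_mem hC.map_nonneg (prodSeq_lower hC hF hB n)
  simpa [hC.map_unit] using this

lemma prodSeq_functional_pos {B : ℕ → X →L[ℝ] X} (hB : ∀ i, B i ∈ 𝓑) (n : ℕ) :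
    0 < φ (prodSeq B n e) :=
  lt_of_lt_of_le (pow_pos hF.a_pos n) (prodSeq_functional_lower hC hF hB n)

lemma norm_unit_pos : 0 < ‖e‖ := by
  rw [norm_pos_iff]
  rintro rfl
  have := hC.map_unit
  simp at this

/-- Along a product of operators of the family, the ratio between the norm of a positive
vector and its value under the pulled back functional improves to a uniform constant. -/
lemma exists_ratio_bound : ∃ R : ℝ, 1 ≤ R ∧ ‖e‖ + 1 / c ≤ R ∧
    ∀ B : ℕ → X →L[ℝ] X, (∀ i, B i ∈ 𝓑) → ∀ n : ℕ, ∀ z ∈ C,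
      ‖z‖ * φ (prodSeq B (n + 2) e) ≤ 2 * R * φ (prodSeq B (n + 2) z) →
      ‖B 0 z‖ * φ (prodSeq (fun i => B (i + 1)) (n + 1) e) ≤ R * φ (prodSeq B (n + 2) z) := by
  have ha := hF.a_pos
  have hL := hF.one_le
  have hc := hC.c_pos
  obtain ⟨δ, hδ, hH⟩ := hF.harnack (a / 2) (by positivity)
  set R : ℝ := max 1 (max (‖e‖ + 1 / c) (c * L * ‖e‖ / δ)) with hR
  have hR1 : 1 ≤ R := le_max_left _ _
  have hR2 : ‖e‖ + 1 / c ≤ R := (le_max_left _ _).trans (le_max_right _ _)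
  have hR3 : c * L * ‖e‖ / δ ≤ R := (le_max_right _ _).trans (le_max_right _ _)
  refine ⟨R, hR1, hR2, fun B hB n z hz hgood => ?_⟩
  have hB1 : ∀ i, (fun i => B (i + 1)) i ∈ 𝓑 := fun i => hB _
  have hB2 : ∀ i, (fun i => B (i + 2)) i ∈ 𝓑 := fun i => hB _
  have hℓ1 := prodSeq_functional_nonneg hC hF hB1 (n + 1)
  have hℓ2 := prodSeq_functional_nonneg hC hF hB2 n
  have hz0 : 0 ≤ φ (prodSeq B (n + 2) z) := prodSeq_functional_nonneg hC hF hB (n + 2) z hz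
  rcases lt_or_ge ‖B 0 z‖ (a / 2 * ‖z‖) with hlt | hge
  · have h1 : a * φ (prodSeq (fun i => B (i + 1)) (n + 1) e) ≤ φ (prodSeq B (n + 2) e) := by
      have := map_le_map_of_sub_mem hℓ1 (hF.lower _ (hB 0))
      simpa [prodSeq_succ] using this
    have h2 : 0 ≤ φ (prodSeq (fun i => B (i + 1)) (n + 1) e) := hℓ1 e hC.mem_e
    calc ‖B 0 z‖ * φ (prodSeq (fun i => B (i + 1)) (n + 1) e)
        ≤ (a / 2 * ‖z‖) * φ (prodSeq (fun i => B (i + 1)) (n + 1) e) := by gcongr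
      _ = ‖z‖ / 2 * (a * φ (prodSeq (fun i => B (i + 1)) (n + 1) e)) := by ring
      _ ≤ ‖z‖ / 2 * φ (prodSeq B (n + 2) e) := by gcongr
      _ ≤ _ := by linarith
  · have h1 := hH _ (hB 0) _ (hB 1) z hz hge
    have h2 := map_le_map_of_sub_mem hℓ2 h1
    have h3 : δ * ‖B 0 z‖ * φ (prodSeq (fun i => B (i + 2)) n e) ≤ φ (prodSeq B (n + 2) z) := by
      simpa [prodSeq_succ] using h2
    have h4 : φ (prodSeq (fun i => B (i + 1)) (n + 1) e) ≤
        c * (L * ‖e‖) * φ (prodSeq (fun i => B (i + 2)) n e) := by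
      have h5 := hC.le_unit hℓ2 (B 1 e)
      have h6 : ‖B 1 e‖ ≤ L * ‖e‖ := (B 1).le_of_opNorm_le (hF.norm_le _ (hB 1)) _
      have h7 := hℓ2 e hC.mem_e
      simp only [ContinuousLinearMap.comp_apply] at h5 h7
      calc _ ≤ _ := h5
        _ ≤ _ := by gcongr
    calc ‖B 0 z‖ * φ (prodSeq (fun i => B (i + 1)) (n + 1) e)
        ≤ ‖B 0 z‖ * (c * (L * ‖e‖) * φ (prodSeq (fun i => B (i + 2)) n e)) := by gcongr
      _ = (c * L * ‖e‖ / δ) * (δ * ‖B 0 z‖ * φ (prodSeq (fun i => B (i + 2)) n e)) := by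
          field_simp
      _ ≤ (c * L * ‖e‖ / δ) * φ (prodSeq B (n + 2) z) := by gcongr
      _ ≤ _ := by gcongr

lemma two_step_lower {R : ℝ} (hR : 1 ≤ R) : ∃ δ : ℝ, 0 < δ ∧
    ∀ B : ℕ → X →L[ℝ] X, (∀ i, B i ∈ 𝓑) → ∀ n : ℕ, ∀ p ∈ C,
      ‖p‖ * φ (prodSeq B (n + 2) e) ≤ 2 * R * φ (prodSeq B (n + 2) p) →
      B 1 (B 0 p) - (δ * (φ (prodSeq B (n + 2) p) / φ (prodSeq B (n + 2) e))) • e ∈ C := by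
  have ha := hF.a_pos
  have hc := hC.c_pos
  obtain ⟨δ, hδ, hH⟩ := hF.harnack (a / (2 * R * c)) (by positivity)
  refine ⟨δ * (a / c), by positivity, fun B hB n p hp hgood => ?_⟩
  have hB1 : ∀ i, (fun i => B (i + 1)) i ∈ 𝓑 := fun i => hB _
  have hℓ1 := prodSeq_functional_nonneg hC hF hB1 (n + 1)
  have hpos := prodSeq_functional_pos hC hF hB (n + 2)
  have h1 : a * φ (prodSeq (fun i => B (i + 1)) (n + 1) e) ≤ φ (prodSeq B (n + 2) e) := by
    have := map_le_map_of_sub_mem hℓ1 (hF.lower _ (hB 0))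
    simpa [prodSeq_succ] using this
  have h2 : φ (prodSeq B (n + 2) p) ≤
      c * ‖B 0 p‖ * φ (prodSeq (fun i => B (i + 1)) (n + 1) e) := hC.le_unit hℓ1 (B 0 p)
  have h3 : a / c * (φ (prodSeq B (n + 2) p) / φ (prodSeq B (n + 2) e)) ≤ ‖B 0 p‖ := by
    rw [div_mul_div_comm, div_le_iff₀ (by positivity)]
    calc a * φ (prodSeq B (n + 2) p)
        ≤ a * (c * ‖B 0 p‖ * φ (prodSeq (fun i => B (i + 1)) (n + 1) e)) := by gcongr
      _ = c * ‖B 0 p‖ * (a * φ (prodSeq (fun i => B (i + 1)) (n + 1) e)) := by ring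
      _ ≤ c * ‖B 0 p‖ * φ (prodSeq B (n + 2) e) := by gcongr
      _ = _ := by ring
  have h4 : a / (2 * R * c) * ‖p‖ ≤ ‖B 0 p‖ := by
    refine le_trans ?_ h3
    have : ‖p‖ ≤ 2 * R * (φ (prodSeq B (n + 2) p) / φ (prodSeq B (n + 2) e)) := by
      rw [← mul_div_assoc, le_div_iff₀ hpos]
      exact hgood
    calc a / (2 * R * c) * ‖p‖ ≤ a / (2 * R * c) *
          (2 * R * (φ (prodSeq B (n + 2) p) / φ (prodSeq B (n + 2) e))) := by gcongr
      _ = _ := by field_simp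
  have h5 := hH _ (hB 0) _ (hB 1) p hp h4
  have h6 := hC.smul_mem (δ * (‖B 0 p‖ - a / c *
    (φ (prodSeq B (n + 2) p) / φ (prodSeq B (n + 2) e))))
    (mul_nonneg hδ.le (by linarith)) e hC.mem_e
  convert hC.add_mem _ h5 _ h6 using 1
  module

lemma norm_le_functional {R : ℝ} (hR : 1 ≤ R)
    (hgood : ∀ B : ℕ → X →L[ℝ] X, (∀ i, B i ∈ 𝓑) → ∀ n : ℕ, ∀ z ∈ C,
      ‖z‖ * φ (prodSeq B (n + 2) e) ≤ 2 * R * φ (prodSeq B (n + 2) z) →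
      ‖B 0 z‖ * φ (prodSeq (fun i => B (i + 1)) (n + 1) e) ≤ R * φ (prodSeq B (n + 2) z))
    (n : ℕ) : ∀ B : ℕ → X →L[ℝ] X, (∀ i, B i ∈ 𝓑) → ∀ z ∈ C,
      ‖z‖ * φ (prodSeq B n e) ≤ R * φ (prodSeq B n z) →
      ‖prodSeq B n z‖ ≤ L * R / a * φ (prodSeq B n z) := by
  have ha := hF.a_pos
  have hL := hF.one_le
  have key : ∀ n ≤ 1, ∀ B : ℕ → X →L[ℝ] X, (∀ i, B i ∈ 𝓑) → ∀ z ∈ C,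
      ‖z‖ * φ (prodSeq B n e) ≤ R * φ (prodSeq B n z) →
      ‖prodSeq B n z‖ ≤ L * R / a * φ (prodSeq B n z) := by
    intro n hn B hB z hz h
    have h1 := prodSeq_norm_le hF hB n z
    have h2 : L ^ n ≤ L := (pow_le_pow_right₀ hL hn).trans_eq (pow_one L)
    have h3 : a ≤ φ (prodSeq B n e) := by
      refine le_trans ?_ (prodSeq_functional_lower hC hF hB n)
      simpa using pow_le_pow_of_le_one ha.le hF.a_le_one hn
    have h4 : a * ‖z‖ ≤ R * φ (prodSeq B n z) := by
      nlinarith [norm_nonneg z]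
    calc ‖prodSeq B n z‖ ≤ L * ‖z‖ := h1.trans (by gcongr)
      _ = L / a * (a * ‖z‖) := by field_simp
      _ ≤ L / a * (R * φ (prodSeq B n z)) := by gcongr
      _ = _ := by ring
  induction n with
  | zero => exact key 0 (by norm_num)
  | succ n ih =>
    cases n with
    | zero => exact key 1 (by norm_num)
    | succ n =>
      intro B hB z hz h
      refine ih (fun i => B (i + 1)) (fun i => hB _) (B 0 z) (hF.pos _ (hB 0) _ hz) ?_
      have h0 := prodSeq_functional_nonneg hC hF hB (n + 2) z hz
      simp only [ContinuousLinearMap.comp_apply] at h0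
      exact hgood B hB n z hz (h.trans (by nlinarith))

lemma functional_smul_le {R : ℝ} (hR : 1 ≤ R)
    (hgood : ∀ B : ℕ → X →L[ℝ] X, (∀ i, B i ∈ 𝓑) → ∀ n : ℕ, ∀ z ∈ C,
      ‖z‖ * φ (prodSeq B (n + 2) e) ≤ 2 * R * φ (prodSeq B (n + 2) z) →
      ‖B 0 z‖ * φ (prodSeq (fun i => B (i + 1)) (n + 1) e) ≤ R * φ (prodSeq B (n + 2) z)) :
    ∃ δ : ℝ, 0 < δ ∧ ∀ n : ℕ, ∀ B : ℕ → X →L[ℝ] X, (∀ i, B i ∈ 𝓑) → ∀ z ∈ C,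
      ‖z‖ * φ (prodSeq B (n + 2) e) ≤ R * φ (prodSeq B (n + 2) z) →
      prodSeq B (n + 2) z - (δ * φ (prodSeq B (n + 2) z)) • e ∈ C := by
  have ha := hF.a_pos
  have hc := hC.c_pos
  have hL := hF.one_le
  have he := norm_unit_pos hC hF
  obtain ⟨δ, hδ, hlow⟩ := two_step_lower hC hF hR
  refine ⟨δ / (c * (L ^ 2 * ‖e‖)), by positivity, fun n => ?_⟩
  induction n with
  | zero =>
    intro B hB z hz h
    have h0 := prodSeq_functional_nonneg hC hF hB 2 z hz
    simp only [ContinuousLinearMap.comp_apply] at h0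
    have h1 := hlow B hB 0 z hz (h.trans (by nlinarith))
    have h2 : φ (prodSeq B 2 e) ≤ c * (L ^ 2 * ‖e‖) := by
      have h3 := hC.le_unit hC.map_nonneg (prodSeq B 2 e)
      rw [hC.map_unit, mul_one] at h3
      exact h3.trans (by gcongr; exact prodSeq_norm_le hF hB 2 e)
    have h3 := prodSeq_functional_pos hC hF hB 2
    have h4 : φ (prodSeq B 2 z) / (c * (L ^ 2 * ‖e‖)) ≤ φ (prodSeq B 2 z) / φ (prodSeq B 2 e) := by
      gcongr
    have h5 := hC.smul_mem (δ * (φ (prodSeq B 2 z) / φ (prodSeq B 2 e)) -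
      δ * (φ (prodSeq B 2 z) / (c * (L ^ 2 * ‖e‖))))
      (by rw [← mul_sub]; exact mul_nonneg hδ.le (by linarith)) e hC.mem_e
    convert hC.add_mem _ h1 _ h5 using 1
    have : prodSeq B (0 + 2) z = B 1 (B 0 z) := rfl
    rw [this]
    simp only [zero_add]
    module
  | succ n ih =>
    intro B hB z hz h
    refine ih (fun i => B (i + 1)) (fun i => hB _) (B 0 z) (hF.pos _ (hB 0) _ hz) ?_
    have h0 := prodSeq_functional_nonneg hC hF hB (n + 3) z hz
    simp only [ContinuousLinearMap.comp_apply] at h0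
    exact hgood B hB (n + 1) z hz (h.trans (by
      change R * φ (prodSeq B (n + 3) z) ≤ 2 * R * φ (prodSeq B (n + 3) z)
      nlinarith))

/-- Vectors in the kernel of the pulled back functional decay exponentially faster than
positive vectors. -/
lemma exists_kernel_contraction {R : ℝ} (hR : 1 ≤ R)
    (hgood : ∀ B : ℕ → X →L[ℝ] X, (∀ i, B i ∈ 𝓑) → ∀ n : ℕ, ∀ z ∈ C,
      ‖z‖ * φ (prodSeq B (n + 2) e) ≤ 2 * R * φ (prodSeq B (n + 2) z) →
      ‖B 0 z‖ * φ (prodSeq (fun i => B (i + 1)) (n + 1) e) ≤ R * φ (prodSeq B (n + 2) z)) :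
    ∃ K θ : ℝ, 0 < K ∧ 0 < θ ∧ θ < 1 ∧ ∀ n : ℕ, ∀ B : ℕ → X →L[ℝ] X, (∀ i, B i ∈ 𝓑) →
      ∀ z ∈ C, ∀ w : X, ∀ M : ℝ, 0 ≤ M → M • z + w ∈ C → M • z - w ∈ C →
      φ (prodSeq B n w) = 0 → ‖z‖ * φ (prodSeq B n e) ≤ R * φ (prodSeq B n z) →
      ‖M • z + w‖ * φ (prodSeq B n e) ≤ 2 * R * (M * φ (prodSeq B n z)) →
      ‖M • z - w‖ * φ (prodSeq B n e) ≤ 2 * R * (M * φ (prodSeq B n z)) →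
      ‖prodSeq B n w‖ ≤ K * θ ^ n * (M * φ (prodSeq B n z)) := by
  have ha := hF.a_pos
  have hc := hC.c_pos
  have hL := hF.one_le
  obtain ⟨δ₁, hδ₁, hlow⟩ := two_step_lower hC hF hR
  obtain ⟨δ, hδ, hδ3, hδ1⟩ : ∃ δ : ℝ, 0 < δ ∧ δ ≤ 1 / 3 ∧ δ * (c * (L ^ 2 * R)) ≤ δ₁ := by
    refine ⟨min (1 / 3) (δ₁ / (c * (L ^ 2 * R))), by positivity, min_le_left _ _, ?_⟩
    rw [← le_div_iff₀ (by positivity)]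
    exact min_le_right _ _
  obtain ⟨θ, hθ0, hθ1, hθ⟩ : ∃ θ : ℝ, 0 < θ ∧ θ < 1 ∧ 1 - δ ≤ θ ^ 2 := by
    refine ⟨1 - δ / 2, by linarith, by linarith, by nlinarith⟩
  refine ⟨2 * R * L ^ 2 / a ^ 2 / θ ^ 2, θ, by positivity, hθ0, hθ1, fun n => ?_⟩
  induction n using Nat.strong_induction_on with
  | _ n ih =>
  intro B hB z hz w M hM hp hq hw hgz hgp hgq
  have hℓz : 0 ≤ φ (prodSeq B n z) := prodSeq_functional_nonneg hC hF hB n z hz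
  have hℓe := prodSeq_functional_pos hC hF hB n
  rcases lt_or_ge n 3 with hn | hn
  · have h1 := prodSeq_norm_le hF hB n w
    have h2 : L ^ n ≤ L ^ 2 := pow_le_pow_right₀ hL (by omega)
    have h3 : a ^ 2 ≤ φ (prodSeq B n e) :=
      (pow_le_pow_of_le_one ha.le hF.a_le_one (by omega)).trans
        (prodSeq_functional_lower hC hF hB n)
    have h4 : ‖w‖ ≤ (‖M • z + w‖ + ‖M • z - w‖) / 2 := by
      have h5 : (2 : ℝ) • w = (M • z + w) - (M • z - w) := by module
      have h6 := norm_sub_le (M • z + w) (M • z - w)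
      rw [← h5, norm_smul, Real.norm_ofNat] at h6
      linarith
    have h5 : ‖w‖ * φ (prodSeq B n e) ≤ 2 * R * (M * φ (prodSeq B n z)) := by
      nlinarith
    have h6 : ‖w‖ * a ^ 2 ≤ 2 * R * (M * φ (prodSeq B n z)) :=
      le_trans (by gcongr) h5
    have h7 : θ ^ 2 ≤ θ ^ n := pow_le_pow_of_le_one hθ0.le hθ1.le (by omega)
    have h8 : 0 ≤ M * φ (prodSeq B n z) := by positivity
    calc ‖prodSeq B n w‖ ≤ L ^ 2 * ‖w‖ := h1.trans (by gcongr)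
      _ = L ^ 2 / a ^ 2 * (‖w‖ * a ^ 2) := by field_simp
      _ ≤ L ^ 2 / a ^ 2 * (2 * R * (M * φ (prodSeq B n z))) := by gcongr
      _ = 2 * R * L ^ 2 / a ^ 2 / θ ^ 2 * θ ^ 2 * (M * φ (prodSeq B n z)) := by field_simp
      _ ≤ _ := by gcongr
  · obtain ⟨n, rfl⟩ : ∃ k, n = k + 3 := ⟨n - 3, by omega⟩
    have hB1 : ∀ i, (fun i => B (i + 1)) i ∈ 𝓑 := fun i => hB _
    have hB2 : ∀ i, (fun i => B (i + 2)) i ∈ 𝓑 := fun i => hB _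
    have hstep : ∀ x, prodSeq B (n + 3) x = prodSeq (fun i => B (i + 2)) (n + 1) (B 1 (B 0 x)) :=
      fun x => rfl
    have two : ∀ x ∈ C, ‖x‖ * φ (prodSeq B (n + 3) e) ≤ 2 * R * φ (prodSeq B (n + 3) x) →
        ‖B 1 (B 0 x)‖ * φ (prodSeq (fun i => B (i + 2)) (n + 1) e) ≤
          R * φ (prodSeq B (n + 3) x) := by
      intro x hx h
      have hx0 : 0 ≤ φ (prodSeq B (n + 3) x) := prodSeq_functional_nonneg hC hF hB (n + 3) x hx
      have h1 := hgood B hB (n + 1) x hx h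
      exact hgood _ hB1 n (B 0 x) (hF.pos _ (hB 0) _ hx) (h1.trans (by
        change R * φ (prodSeq B (n + 3) x) ≤ 2 * R * φ (prodSeq B (n + 3) x)
        nlinarith))
    set ℓz := φ (prodSeq B (n + 3) z) with hℓzdef
    set ℓe := φ (prodSeq B (n + 3) e) with hℓedef
    set ℓe2 := φ (prodSeq (fun i => B (i + 2)) (n + 1) e) with hℓe2
    have hℓe2pos : 0 < ℓe2 := prodSeq_functional_pos hC hF hB2 (n + 1)
    have hz2 := two z hz (hgz.trans (by nlinarith))
    set z2 := B 1 (B 0 z) with hz2def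
    have hz2C : z2 ∈ C := hF.pos _ (hB 1) _ (hF.pos _ (hB 0) _ hz)
    have hzn : ‖z2‖ * ℓe ≤ L ^ 2 * R * ℓz := by
      have h1 : ‖z2‖ ≤ L ^ 2 * ‖z‖ := prodSeq_norm_le hF hB 2 z
      calc ‖z2‖ * ℓe ≤ L ^ 2 * ‖z‖ * ℓe := by gcongr
        _ = L ^ 2 * (‖z‖ * ℓe) := by ring
        _ ≤ L ^ 2 * (R * ℓz) := by gcongr
        _ = _ := by ring
    have main : ∀ u : X, M • z + u ∈ C → φ (prodSeq B (n + 3) u) = 0 →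
        ‖M • z + u‖ * ℓe ≤ 2 * R * (M * ℓz) →
        (M * (1 - δ)) • z2 + B 1 (B 0 u) ∈ C ∧
        ‖(M * (1 - δ)) • z2 + B 1 (B 0 u)‖ * ℓe2 ≤ 2 * R * (M * (1 - δ) * ℓz) := by
      intro u hu hu0 hgu
      have hval : φ (prodSeq B (n + 3) (M • z + u)) = M * ℓz := by simp [hu0, hℓzdef]
      have h1 := two _ hu (by rw [hval]; exact hgu)
      have h2 := hlow B hB (n + 1) _ hu
      have e3 : n + 1 + 2 = n + 3 := rfl
      rw [e3, hval] at h2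
      have h2 := h2 hgu
      rw [hval] at h1
      have h3 : B 1 (B 0 (M • z + u)) = M • z2 + B 1 (B 0 u) := by simp [hz2def]
      rw [h3] at h1 h2
      have h4 : (M * (1 - δ)) • z2 + B 1 (B 0 u) = (M • z2 + B 1 (B 0 u)) - (M * δ) • z2 := by
        module
      constructor
      · have h5 := hC.smul_mem (M * δ) (by positivity) _ (hC.unit_sub z2)
        have h6 : 0 ≤ δ₁ * (M * ℓz / ℓe) - M * δ * (c * ‖z2‖) := by
          rw [sub_nonneg, ← mul_div_assoc, le_div_iff₀ hℓe]
          calc M * δ * (c * ‖z2‖) * ℓe = M * δ * c * (‖z2‖ * ℓe) := by ring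
            _ ≤ M * δ * c * (L ^ 2 * R * ℓz) := by gcongr
            _ = δ * (c * (L ^ 2 * R)) * (M * ℓz) := by ring
            _ ≤ δ₁ * (M * ℓz) := by gcongr
        have h7 := hC.smul_mem _ h6 e hC.mem_e
        have h8 := hC.add_mem _ (hC.add_mem _ h2 _ h5) _ h7
        convert h8 using 1
        module
      · rw [h4]
        calc ‖M • z2 + B 1 (B 0 u) - (M * δ) • z2‖ * ℓe2
            ≤ (‖M • z2 + B 1 (B 0 u)‖ + ‖(M * δ) • z2‖) * ℓe2 := by
              gcongr; exact norm_sub_le _ _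
          _ = ‖M • z2 + B 1 (B 0 u)‖ * ℓe2 + M * δ * (‖z2‖ * ℓe2) := by
              rw [norm_smul, Real.norm_of_nonneg (by positivity)]; ring
          _ ≤ R * (M * ℓz) + M * δ * (R * ℓz) := by gcongr
          _ = R * M * ℓz * (1 + δ) := by ring
          _ ≤ R * M * ℓz * (2 * (1 - δ)) := by gcongr; linarith
          _ = _ := by ring
    have hneg : φ (prodSeq B (n + 3) (-w)) = 0 := by simp [hw]
    obtain ⟨hp1, hp2⟩ := main w hp hw hgp
    obtain ⟨hq1, hq2⟩ := main (-w) (by rwa [← sub_eq_add_neg]) hneg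
      (by rwa [← sub_eq_add_neg])
    rw [map_neg, map_neg, ← sub_eq_add_neg] at hq1 hq2
    have hM1 : 0 ≤ M * (1 - δ) := mul_nonneg hM (by linarith)
    have hfin := ih (n + 1) (by omega) _ hB2 z2 hz2C (B 1 (B 0 w)) (M * (1 - δ)) hM1 hp1 hq1
      hw hz2 hp2 hq2
    have h8 : 0 ≤ M * ℓz := by positivity
    calc ‖prodSeq B (n + 3) w‖ ≤ 2 * R * L ^ 2 / a ^ 2 / θ ^ 2 * θ ^ (n + 1) *
          (M * (1 - δ) * ℓz) := hfin
      _ = 2 * R * L ^ 2 / a ^ 2 / θ ^ 2 * θ ^ (n + 1) * (M * ℓz) * (1 - δ) := by ring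
      _ ≤ 2 * R * L ^ 2 / a ^ 2 / θ ^ 2 * θ ^ (n + 1) * (M * ℓz) * θ ^ 2 := by gcongr
      _ = _ := by ring

/-- Exponential separation for products of operators of a Harnack family. -/
theorem exists_exponential_separation : ∃ K θ δ : ℝ, 1 ≤ K ∧ 0 < θ ∧ θ < 1 ∧ 0 < δ ∧
    ∀ B : ℕ → X →L[ℝ] X, (∀ i, B i ∈ 𝓑) → ∀ n : ℕ,
      prodSeq B n e - (δ * φ (prodSeq B n e)) • e ∈ C ∧
      ‖prodSeq B n e‖ ≤ K * φ (prodSeq B n e) ∧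
      ∀ d : X, prodSeq B n d ∈ C ∨ -prodSeq B n d ∈ C ∨
        ‖prodSeq B n d‖ ≤ K * θ ^ n * φ (prodSeq B n e) * ‖d‖ := by
  have ha := hF.a_pos
  have hc := hC.c_pos
  have hL := hF.one_le
  have he := norm_unit_pos hC hF
  obtain ⟨R, hR1, hR2, hgood⟩ := exists_ratio_bound hC hF
  have hRe : ‖e‖ ≤ R := by have : 0 < 1 / c := by positivity
                           linarith
  obtain ⟨δ₁, hδ₁, hlow⟩ := functional_smul_le hC hF hR1 hgood
  obtain ⟨K₁, θ, hK₁, hθ0, hθ1, hcontr⟩ := exists_kernel_contraction hC hF hR1 hgood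
  obtain ⟨δ, hδ0, hδ1, hδ2, hδ3⟩ : ∃ δ : ℝ, 0 < δ ∧ δ ≤ 1 ∧ δ ≤ δ₁ ∧
      δ * (c * (L * ‖e‖)) ≤ a := by
    refine ⟨min 1 (min δ₁ (a / (c * (L * ‖e‖)))), by positivity, min_le_left _ _,
      (min_le_right _ _).trans (min_le_left _ _), ?_⟩
    rw [← le_div_iff₀ (by positivity)]
    exact (min_le_right _ _).trans (min_le_right _ _)
  have key : ∀ B : ℕ → X →L[ℝ] X, (∀ i, B i ∈ 𝓑) → ∀ n : ℕ,
      prodSeq B n e - (δ * φ (prodSeq B n e)) • e ∈ C := by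
    intro B hB n
    have hpos := prodSeq_functional_pos hC hF hB n
    match n with
    | 0 =>
      have := hC.smul_mem (1 - δ) (by linarith) e hC.mem_e
      convert this using 1
      simp only [prodSeq_zero, hC.map_unit]
      module
    | 1 =>
      have h1 := hF.lower _ (hB 0)
      have h2 : φ (B 0 e) ≤ c * (L * ‖e‖) := by
        have h3 := hC.le_unit hC.map_nonneg (B 0 e)
        rw [hC.map_unit, mul_one] at h3
        refine h3.trans ?_
        gcongr
        exact (B 0).le_of_opNorm_le (hF.norm_le _ (hB 0)) _
      have h3 : 0 ≤ a - δ * φ (B 0 e) := by nlinarith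
      have h4 := hC.add_mem _ h1 _ (hC.smul_mem _ h3 e hC.mem_e)
      convert h4 using 1
      have : prodSeq B 1 e = B 0 e := rfl
      rw [this]
      module
    | n + 2 =>
      have h1 := hlow n B hB e hC.mem_e (by gcongr)
      have h2 := hC.smul_mem ((δ₁ - δ) * φ (prodSeq B (n + 2) e))
        (mul_nonneg (by linarith) hpos.le) e hC.mem_e
      convert hC.add_mem _ h1 _ h2 using 1
      module
  set K₂ : ℝ := K₁ * (c * (1 + c * ‖e‖)) with hK₂
  have hK₂pos : 0 < K₂ := by positivity
  set K₃ : ℝ := L * R / a with hK₃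
  have hK₃pos : 0 < K₃ := by positivity
  set K : ℝ := 1 + K₃ + K₂ + K₃ * (c * K₂ / δ) with hK
  have hsum : 0 < K₃ * (c * K₂ / δ) := by positivity
  refine ⟨K, θ, δ, by linarith, hθ0, hθ1, hδ0, fun B hB n => ⟨key B hB n, ?_, ?_⟩⟩
  · have hpos := prodSeq_functional_pos hC hF hB n
    refine (norm_le_functional hC hF hR1 hgood n B hB e hC.mem_e (by gcongr)).trans ?_
    gcongr
    linarith
  · intro d
    have hpos := prodSeq_functional_pos hC hF hB n
    set ℓe := φ (prodSeq B n e) with hℓe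
    have hℓ := prodSeq_functional_nonneg hC hF hB n
    set α := φ (prodSeq B n d) / ℓe with hα
    have hαabs : |α| ≤ c * ‖d‖ := by
      rw [hα, abs_div, abs_of_pos hpos, div_le_iff₀ hpos, abs_le]
      exact ⟨hC.neg_unit_le hℓ d, hC.le_unit hℓ d⟩
    set w := d - α • e with hw
    have hw0 : φ (prodSeq B n w) = 0 := by
      simp only [hw, map_sub, map_smul, smul_eq_mul, hα, ← hℓe]
      field_simp
      ring
    have hwn : ‖w‖ ≤ (1 + c * ‖e‖) * ‖d‖ := by
      calc ‖w‖ ≤ ‖d‖ + ‖α • e‖ := norm_sub_le _ _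
        _ = ‖d‖ + |α| * ‖e‖ := by rw [norm_smul, Real.norm_eq_abs]
        _ ≤ ‖d‖ + c * ‖d‖ * ‖e‖ := by gcongr
        _ = _ := by ring
    have hbound : ∀ u : X, ‖u‖ = ‖w‖ →
        ‖(c * ‖w‖) • e + u‖ * ℓe ≤ 2 * R * (c * ‖w‖ * ℓe) := by
      intro u hu
      have h1 : ‖(c * ‖w‖) • e + u‖ ≤ 2 * R * (c * ‖w‖) := by
        calc ‖(c * ‖w‖) • e + u‖ ≤ ‖(c * ‖w‖) • e‖ + ‖u‖ := norm_add_le _ _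
          _ = (c * ‖w‖) * ‖e‖ + ‖w‖ := by
              rw [norm_smul, hu, Real.norm_of_nonneg (by positivity)]
          _ = (‖e‖ + 1 / c) * (c * ‖w‖) := by field_simp
          _ ≤ R * (c * ‖w‖) := by gcongr
          _ ≤ _ := by nlinarith [show 0 ≤ R * (c * ‖w‖) by positivity]
      calc _ ≤ 2 * R * (c * ‖w‖) * ℓe := by gcongr
        _ = _ := by ring
    have hdec := hcontr n B hB e hC.mem_e w (c * ‖w‖) (by positivity) (hC.unit w)
      (hC.unit_sub w) hw0 (by gcongr) (hbound w rfl)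
      (by rw [sub_eq_add_neg]; exact hbound (-w) (norm_neg w))
    have hdec2 : ‖prodSeq B n w‖ ≤ K₂ * θ ^ n * ℓe * ‖d‖ := by
      calc _ ≤ K₁ * θ ^ n * (c * ‖w‖ * ℓe) := hdec
        _ ≤ K₁ * θ ^ n * (c * ((1 + c * ‖e‖) * ‖d‖) * ℓe) := by gcongr
        _ = _ := by rw [hK₂]; ring
    have hd : prodSeq B n d = α • prodSeq B n e + prodSeq B n w := by
      simp only [hw, map_sub, map_smul]; module
    rcases le_or_gt (|α| * δ * ℓe) (c * ‖prodSeq B n w‖) with hle | hgt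
    · right; right
      have h1 : |α| * ℓe ≤ c * K₂ / δ * (θ ^ n * ℓe * ‖d‖) := by
        have : |α| * δ * ℓe ≤ c * (K₂ * θ ^ n * ℓe * ‖d‖) := hle.trans (by gcongr)
        rw [div_mul_eq_mul_div, le_div_iff₀ hδ0]
        nlinarith
      have h2 : ‖prodSeq B n e‖ ≤ K₃ * ℓe :=
        norm_le_functional hC hF hR1 hgood n B hB e hC.mem_e (by gcongr)
      have h3 : 0 ≤ θ ^ n * ℓe * ‖d‖ := by positivity
      calc ‖prodSeq B n d‖ ≤ ‖α • prodSeq B n e‖ + ‖prodSeq B n w‖ := by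
            rw [hd]; exact norm_add_le _ _
        _ = |α| * ‖prodSeq B n e‖ + ‖prodSeq B n w‖ := by rw [norm_smul, Real.norm_eq_abs]
        _ ≤ |α| * (K₃ * ℓe) + K₂ * θ ^ n * ℓe * ‖d‖ := by gcongr
        _ = K₃ * (|α| * ℓe) + K₂ * (θ ^ n * ℓe * ‖d‖) := by ring
        _ ≤ K₃ * (c * K₂ / δ * (θ ^ n * ℓe * ‖d‖)) + K₂ * (θ ^ n * ℓe * ‖d‖) := by gcongr
        _ = (K₂ + K₃ * (c * K₂ / δ)) * (θ ^ n * ℓe * ‖d‖) := by ring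
        _ ≤ K * (θ ^ n * ℓe * ‖d‖) := by gcongr; linarith
        _ = _ := by ring
    · have h1 := key B hB n
      rcases le_total 0 α with hα0 | hα0
      · left
        rw [abs_of_nonneg hα0] at hgt
        have h2 := hC.smul_mem α hα0 _ h1
        have h3 := hC.smul_mem (α * δ * ℓe - c * ‖prodSeq B n w‖) (by linarith) e hC.mem_e
        have h4 := hC.add_mem _ (hC.add_mem _ h2 _ h3) _ (hC.unit (prodSeq B n w))
        rw [hd]
        convert h4 using 1
        module
      · right; left
        rw [abs_of_nonpos hα0] at hgt
        have h2 := hC.smul_mem (-α) (by linarith) _ h1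
        have h3 := hC.smul_mem (-α * δ * ℓe - c * ‖prodSeq B n w‖) (by linarith) e hC.mem_e
        have h4 := hC.add_mem _ (hC.add_mem _ h2 _ h3) _ (hC.unit_sub (prodSeq B n w))
        rw [hd]
        convert h4 using 1
        module

/-- A small perturbation of a product of operators of the family changes its growth on the
order unit by an arbitrarily small exponential factor. -/
lemma exists_perturbation_bound {q : ℝ} (hq : 1 < q) : ∃ ε : ℝ, 0 < ε ∧
    ∀ B T : ℕ → X →L[ℝ] X, (∀ i, B i ∈ 𝓑) → (∀ i, T i ∈ 𝓑) → ∀ n : ℕ,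
      (∀ i < n, ‖B i - T i‖ ≤ ε) → φ (prodSeq B n e) ≤ q ^ n * φ (prodSeq T n e) := by
  have ha := hF.a_pos
  have hc := hC.c_pos
  obtain ⟨K, θ, δ, hK, -, -, hδ, hsep⟩ := exists_exponential_separation hC hF
  set ε := (q - 1) * (δ * a) / (c * K) with hε
  have hεpos : 0 < ε := by
    have : 0 < q - 1 := by linarith
    positivity
  refine ⟨ε, hεpos, fun B T hB hT n hBT => ?_⟩
  have main : ∀ m ≤ n, q ^ m • prodSeq T m e - prodSeq B m e ∈ C := by
    intro m
    induction m with
    | zero => intro _; simpa using hC.zero_mem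
    | succ m ih =>
      intro hm
      have h1 := hF.pos _ (hB m) _ (ih (by omega))
      rw [prodSeq_succ_apply, prodSeq_succ_apply]
      set u := prodSeq T m e with hu
      obtain ⟨hu1, hu2, -⟩ := hsep T hT m
      rw [← hu] at hu1 hu2
      have hφu : 0 < φ u := prodSeq_functional_pos hC hF hT m
      have h2 : T m u - (δ * φ u * a) • e ∈ C := by
        have h3 := hF.pos _ (hT m) _ hu1
        have h4 := hC.smul_mem (δ * φ u) (by positivity) _ (hF.lower _ (hT m))
        convert hC.add_mem _ h3 _ h4 using 1
        rw [map_sub, map_smul]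
        module
      have h3 := hC.unit_sub ((B m - T m) u)
      have h4 : c * ‖(B m - T m) u‖ ≤ (q - 1) * (δ * φ u * a) := by
        calc c * ‖(B m - T m) u‖ ≤ c * (ε * (K * φ u)) := by
              gcongr
              exact ((B m - T m).le_of_opNorm_le (hBT m (by omega)) u).trans (by gcongr)
          _ = _ := by rw [hε]; field_simp
      have h5 := hC.smul_mem _ (sub_nonneg.2 h4) e hC.mem_e
      have h6 := hC.smul_mem (q - 1) (by linarith) _ h2
      have h7 := hC.smul_mem (q ^ m) (by positivity) _
        (hC.add_mem _ (hC.add_mem _ h3 _ h5) _ h6)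
      convert hC.add_mem _ h7 _ h1 using 1
      simp only [map_sub, map_smul, _root_.sub_apply]
      module
  have := map_le_map_of_sub_mem hC.map_nonneg (main n le_rfl)
  simpa using this

end PositiveOperators

section GoodTimes

open scoped Classical in
/-- A Pliss-type lemma: a real sequence with steps bounded below by `-H` and decaying at a
linear rate `κ` has, in some window of length `m`, more than `N` times dominating the whole
future. -/
lemma exists_window_good_times {s : ℕ → ℝ} {κ H D : ℝ} (hstep : ∀ n, s n - H ≤ s (n + 1))
    (hs : ∀ n, s n ≤ D - κ * n) (hκ : 0 < κ) {N m : ℕ} (hH : 0 ≤ H) (hm : N * H < κ * m) :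
    ∃ t : ℕ, N < ((Finset.range m).filter fun i => ∀ j, s (t + i + j) ≤ s (t + i)).card := by
  by_contra! hcon
  have hbdd : ∀ n, BddAbove (Set.range fun j => s (n + j)) := by
    intro n
    refine ⟨D, ?_⟩
    rintro _ ⟨j, rfl⟩
    have := hs (n + j)
    have h2 : 0 ≤ κ * ((n + j : ℕ) : ℝ) := by positivity
    simp only
    linarith
  set S : ℕ → ℝ := fun n => ⨆ j, s (n + j) with hS
  have hle : ∀ n j, s (n + j) ≤ S n := fun n j => le_ciSup (hbdd n) j
  have hSub : ∀ n, S n ≤ D - κ * n := by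
    intro n
    refine ciSup_le fun j => (hs _).trans ?_
    have : (n : ℝ) ≤ ((n + j : ℕ) : ℝ) := by exact_mod_cast Nat.le_add_right n j
    nlinarith
  have hsucc : ∀ n, S n ≤ max (s n) (S (n + 1)) := by
    intro n
    refine ciSup_le fun j => ?_
    cases j with
    | zero => exact le_max_left _ _
    | succ j =>
      refine le_max_of_le_right ?_
      have := hle (n + 1) j
      rwa [show n + 1 + j = n + (j + 1) by omega] at this
  have hgood : ∀ n, S n - H ≤ S (n + 1) := by
    intro n
    rcases le_max_iff.1 (hsucc n) with h | h
    · have h1 := hle (n + 1) 0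
      have h2 := hstep n
      simp only [add_zero] at h1
      linarith
    · linarith
  have hbad : ∀ n, (¬ ∀ j, s (n + j) ≤ s n) → S n ≤ S (n + 1) := by
    intro n hn
    push Not at hn
    obtain ⟨j, hj⟩ := hn
    rcases le_max_iff.1 (hsucc n) with h | h
    · exact absurd (hle n j) (by linarith)
    · exact h
  have hwin : ∀ t k, S t -
      H * ((Finset.range k).filter fun i => ∀ j, s (t + i + j) ≤ s (t + i)).card ≤ S (t + k) := by
    intro t k
    induction k with
    | zero => simp
    | succ k ih =>
      rw [Finset.range_add_one, Finset.filter_insert]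
      split_ifs with h
      · rw [Finset.card_insert_of_notMem (by simp)]
        have := hgood (t + k)
        push_cast
        rw [← add_assoc]
        linarith
      · exact ih.trans (hbad (t + k) h)
  have hiter : ∀ i : ℕ, S 0 - i * (N * H) ≤ S (i * m) := by
    intro i
    induction i with
    | zero => simp
    | succ i ih =>
      have h1 := hwin (i * m) m
      have h2 : (((Finset.range m).filter fun j =>
        ∀ l, s (i * m + j + l) ≤ s (i * m + j)).card : ℝ) ≤ N := by exact_mod_cast hcon (i * m)
      rw [add_mul, one_mul]
      push_cast
      nlinarith
  obtain ⟨i, hi⟩ := exists_nat_gt ((D - S 0) / (κ * m - N * H))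
  rw [div_lt_iff₀ (by linarith)] at hi
  have h1 := hiter i
  have h2 := hSub (i * m)
  push_cast at h2
  nlinarith

open scoped Classical in
lemma exists_window_slow_growth {a q : ℝ} (ha : 0 < a) (hq : 1 < q) (N : ℕ) :
    ∃ m : ℕ, 0 < m ∧ ∀ f : ℕ → ℝ, (∀ n, 0 < f n) → (∀ n, a * f n ≤ f (n + 1)) →
      (∀ r : ℝ, 1 < r → ∃ D : ℝ, ∀ n, f n ≤ D * r ^ n) →
      ∃ t : ℕ, N < ((Finset.range m).filter
        fun i => ∀ j, f (t + i + j) ≤ q ^ j * f (t + i)).card := by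
  have hlq : 0 < Real.log q := Real.log_pos hq
  set H : ℝ := Real.log q + |Real.log a| with hH
  have hH0 : 0 ≤ H := by positivity
  obtain ⟨m, hm⟩ := exists_nat_gt (N * H / (Real.log q / 2))
  rw [div_lt_iff₀ (by positivity), mul_comm] at hm
  refine ⟨m + 1, by omega, fun f hf hstep hslow => ?_⟩
  set s : ℕ → ℝ := fun n => Real.log (f n) - n * Real.log q with hs
  obtain ⟨D, hD⟩ := hslow (√q) (by rw [Real.lt_sqrt] <;> linarith)
  have hDpos : 0 < D := by
    have := (hf 0).trans_le (hD 0)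
    simpa using this
  have h1 : ∀ n, s n - H ≤ s (n + 1) := by
    intro n
    have h2 := Real.log_le_log (mul_pos ha (hf n)) (hstep n)
    rw [Real.log_mul ha.ne' (hf n).ne'] at h2
    have h3 := neg_abs_le (Real.log a)
    simp only [hs, hH]
    push_cast
    linarith
  have h2 : ∀ n, s n ≤ Real.log D - Real.log q / 2 * n := by
    intro n
    have h3 := Real.log_le_log (hf n) (hD n)
    have hsq : 0 < √q := Real.sqrt_pos.2 (by linarith)
    rw [Real.log_mul hDpos.ne' (by positivity), Real.log_pow, Real.log_sqrt (by linarith)] at h3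
    simp only [hs]
    linarith
  obtain ⟨t, ht⟩ := exists_window_good_times (m := m + 1) (N := N) h1 h2 (by positivity) hH0
    (by push_cast; linarith)
  refine ⟨t, ht.trans_le (Finset.card_le_card fun i hi => ?_)⟩
  simp only [Finset.mem_filter] at hi ⊢
  refine ⟨hi.1, fun j => ?_⟩
  have h3 := hi.2 j
  simp only [hs] at h3
  push_cast at h3
  have h4 : Real.log (f (t + i + j)) ≤ Real.log (q ^ j * f (t + i)) := by
    rw [Real.log_mul (by positivity) (hf _).ne', Real.log_pow]
    linarith
  exact (Real.log_le_log_iff (hf _) (mul_pos (by positivity) (hf _))).1 h4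

lemma IsCompact.exists_dist_lt_of_card_lt {X : Type*} [PseudoMetricSpace X] {K : Set X}
    (hK : IsCompact K) {r : ℝ} (hr : 0 < r) :
    ∃ N : ℕ, ∀ (s : Finset ℕ) (y : ℕ → X), (∀ i ∈ s, y i ∈ K) → N < s.card →
      ∃ i ∈ s, ∃ j ∈ s, i < j ∧ dist (y i) (y j) < r := by
  obtain ⟨t, -, htf, ht⟩ := hK.finite_cover_balls (half_pos hr)
  refine ⟨htf.toFinset.card, fun s y hy hs => ?_⟩
  have : ∀ i, ∃ x : X, i ∈ s → x ∈ t ∧ y i ∈ ball x (r / 2) := by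
    intro i
    by_cases hi : i ∈ s
    · have := ht (hy i hi)
      simp only [mem_iUnion] at this
      obtain ⟨x, hx, hxy⟩ := this
      exact ⟨x, fun _ => ⟨hx, hxy⟩⟩
    · exact ⟨y i, fun h => absurd h hi⟩
  choose g hg using this
  obtain ⟨i, hi, j, hj, hij, heq⟩ := Finset.exists_ne_map_eq_of_card_lt_of_maps_to hs
    (f := g) (fun i hi => by simpa using (hg i hi).1)
  have hd : dist (y i) (y j) < r := by
    have h1 := (hg i hi).2
    have h2 := (hg j hj).2
    rw [mem_ball] at h1 h2
    rw [← heq] at h2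
    have := dist_triangle_right (y i) (y j) (g i)
    linarith
  rcases lt_or_gt_of_ne hij with h | h
  · exact ⟨i, hi, j, hj, h, hd⟩
  · exact ⟨j, hj, i, hi, h, by rwa [dist_comm]⟩

end GoodTimes

section Cones

variable {X : Type*} [NormedAddCommGroup X] [NormedSpace ℝ X] {C : Set X}

lemma StronglyOrderedCone.exists_isUnitCone [Nontrivial X] (hC : StronglyOrderedCone C) :
    ∃ (e : X) (φ : X →L[ℝ] ℝ) (c : ℝ), IsUnitCone C e φ c := by
  obtain ⟨⟨hcl, hconv, hsmul, hpt⟩, e, he⟩ := hC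
  have h0 : (0 : X) ∈ C := by
    have : (0 : X) ∈ C ∩ (-C) := by rw [hpt]; rfl
    exact this.1
  have hpt' : ∀ x ∈ C, -x ∈ C → x = 0 := by
    intro x hx hx'
    have : x ∈ C ∩ (-C) := ⟨hx, by simpa using hx'⟩
    rw [hpt] at this
    exact this
  have hsmul' : ∀ r : ℝ, 0 ≤ r → ∀ x ∈ C, r • x ∈ C := by
    intro r hr x hx
    rcases hr.eq_or_lt with rfl | hr
    · simpa using h0
    · exact hsmul r hr x hx
  have hadd : ∀ x ∈ C, ∀ y ∈ C, x + y ∈ C := by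
    intro x hx y hy
    have := hsmul 2 two_pos _ (hconv hx hy (by norm_num : (0 : ℝ) ≤ 1 / 2)
      (by norm_num : (0 : ℝ) ≤ 1 / 2) (by norm_num))
    rw [smul_add, smul_smul, smul_smul] at this
    norm_num at this
    exact this
  have hadd' : ∀ x ∈ C, ∀ y ∈ interior C, x + y ∈ interior C := by
    intro x hx y hy
    rw [mem_interior_iff_mem_nhds, Metric.mem_nhds_iff] at hy ⊢
    obtain ⟨r, hr, hb⟩ := hy
    refine ⟨r, hr, fun z hz => ?_⟩
    have : z - x ∈ C := hb (by
      rw [mem_ball, dist_eq_norm] at hz ⊢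
      rwa [sub_sub])
    simpa using hadd x hx _ this
  have hunit : ∃ c : ℝ, 0 < c ∧ ∀ w : X, (c * ‖w‖) • e + w ∈ C := by
    have he' := he
    rw [mem_interior_iff_mem_nhds, Metric.mem_nhds_iff] at he'
    obtain ⟨r, hr, hb⟩ := he'
    refine ⟨2 / r, by positivity, fun w => ?_⟩
    rcases eq_or_ne w 0 with rfl | hw
    · simpa using h0
    have hw' : 0 < ‖w‖ := norm_pos_iff.2 hw
    have h1 : e + (r / (2 * ‖w‖)) • w ∈ C := hb (by
      rw [mem_ball, dist_eq_norm, add_sub_cancel_left, norm_smul,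
          Real.norm_of_nonneg (by positivity)]
      have : r / (2 * ‖w‖) * ‖w‖ = r / 2 := by field_simp
      rw [this]; linarith)
    have h2 := hsmul (2 / r * ‖w‖) (by positivity) _ h1
    rw [smul_add, smul_smul] at h2
    have : 2 / r * ‖w‖ * (r / (2 * ‖w‖)) = 1 := by field_simp
    rwa [this, one_smul] at h2
  obtain ⟨c, hc, hunit⟩ := hunit
  have h0i : (0 : X) ∉ interior C := by
    intro h
    rw [mem_interior_iff_mem_nhds, Metric.mem_nhds_iff] at h
    obtain ⟨r, hr, hb⟩ := h
    obtain ⟨x, hx⟩ := exists_ne (0 : X)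
    have hx' : 0 < ‖x‖ := norm_pos_iff.2 hx
    have hn : ‖(r / (2 * ‖x‖)) • x‖ < r := by
      rw [norm_smul, Real.norm_of_nonneg (by positivity)]
      have : r / (2 * ‖x‖) * ‖x‖ = r / 2 := by field_simp
      rw [this]; linarith
    have := hpt' ((r / (2 * ‖x‖)) • x) (hb (by simpa using hn)) (hb (by simpa using hn))
    rw [smul_eq_zero] at this
    rcases this with h | h
    · have : 0 < r / (2 * ‖x‖) := by positivity
      linarith
    · exact hx h
  obtain ⟨f, hf⟩ := geometric_hahn_banach_open_point hconv.interior isOpen_interior h0i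
  rw [map_zero] at hf
  have hfe := hf e he
  refine ⟨e, (f e)⁻¹ • f, c, hcl, h0, hadd, hsmul', hpt', hc, hunit, he, fun x hx => ?_, ?_⟩
  · have hfx : f x ≤ 0 := by
      refine le_of_forall_pos_le_add fun ε hε => ?_
      have hpos : 0 < ε / (- f e) := div_pos hε (by linarith)
      have := hf (x + (ε / (- f e)) • e) (hadd' x hx _ (by
        rw [mem_interior_iff_mem_nhds] at he ⊢
        have := smul_mem_nhds_smul₀ hpos.ne' he
        refine Filter.mem_of_superset this ?_
        rintro _ ⟨y, hy, rfl⟩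
        exact hsmul _ hpos _ hy))
      rw [map_add, map_smul, smul_eq_mul] at this
      have h3 : ε / (- f e) * f e = -ε := by
        have := hfe.ne
        field_simp
      linarith
    simp only [_root_.smul_apply, smul_eq_mul]
    exact mul_nonneg_of_nonpos_of_nonpos (inv_nonpos.2 hfe.le) hfx
  · simp [hfe.ne]

variable {e : X} {φ : X →L[ℝ] ℝ} {c : ℝ}

lemma IsUnitCone.mem_interior (hC : IsUnitCone C e φ c) {y : X} {δ : ℝ} (hδ : 0 < δ)
    (h : y - δ • e ∈ C) : y ∈ interior C := by
  rw [mem_interior_iff_mem_nhds, Metric.mem_nhds_iff]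
  refine ⟨δ / c, div_pos hδ hC.c_pos, fun z hz => ?_⟩
  rw [mem_ball, dist_eq_norm, lt_div_iff₀ hC.c_pos] at hz
  have h1 := hC.add_mem _ h _ (hC.add_mem _ (hC.smul_mem (δ - c * ‖z - y‖) (by linarith) e hC.mem_e)
    _ (hC.unit (z - y)))
  convert h1 using 1
  module

lemma exists_sub_smul_mem_of_isCompact {D : Set X} (hD : IsCompact D)
    (h : D ⊆ interior C) (e : X) : ∃ δ : ℝ, 0 < δ ∧ ∀ x ∈ D, x - δ • e ∈ C := by
  obtain ⟨r, hr, hsub⟩ := hD.exists_thickening_subset_open isOpen_interior h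
  refine ⟨r / (2 * (‖e‖ + 1)), by positivity, fun x hx => interior_subset (hsub ?_)⟩
  rw [mem_thickening_iff]
  refine ⟨x, hx, ?_⟩
  rw [dist_eq_norm, sub_sub_cancel_left, norm_neg, norm_smul, Real.norm_of_nonneg (by positivity)]
  have h1 : r / (2 * (‖e‖ + 1)) * ‖e‖ ≤ r / (2 * (‖e‖ + 1)) * (‖e‖ + 1) := by
    gcongr; linarith
  have h2 : r / (2 * (‖e‖ + 1)) * (‖e‖ + 1) = r / 2 := by field_simp
  linarith

end Cones

section CompactOperators

variable {X : Type*} [NormedAddCommGroup X] [NormedSpace ℝ X]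

lemma totallyBounded_of_forall_exists_dist_lt {α : Type*} [PseudoMetricSpace α] {S : Set α}
    (h : ∀ ε > 0, ∃ S' : Set α, TotallyBounded S' ∧ ∀ x ∈ S, ∃ y ∈ S', dist x y < ε) :
    TotallyBounded S := by
  rw [Metric.totallyBounded_iff]
  intro ε hε
  obtain ⟨S', hS', hx⟩ := h (ε / 2) (half_pos hε)
  obtain ⟨t, ht, hcov⟩ := Metric.totallyBounded_iff.1 hS' (ε / 2) (half_pos hε)
  refine ⟨t, ht, fun x hxS => ?_⟩
  obtain ⟨y, hy, hxy⟩ := hx x hxS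
  obtain ⟨z, hz, hyz⟩ := mem_iUnion₂.1 (hcov hy)
  refine mem_iUnion₂.2 ⟨z, hz, ?_⟩
  rw [mem_ball] at hyz ⊢
  linarith [dist_triangle x y z]

lemma IsCompactMap.isCompactOperator_fderiv [CompleteSpace X] {F : X → X} (hF : IsCompactMap F)
    {x : X} (hd : DifferentiableAt ℝ F x) : IsCompactOperator (fderiv ℝ F x) := by
  rw [← ContinuousLinearMap.coe_coe, isCompactOperator_iff_isCompact_closure_image_closedBall
    (fderiv ℝ F x : X →ₗ[ℝ] X) one_pos, ContinuousLinearMap.coe_coe]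
  refine TotallyBounded.isCompact_of_isClosed (TotallyBounded.closure ?_) isClosed_closure
  refine totallyBounded_of_forall_exists_dist_lt fun ε hε => ?_
  have h1 := hd.hasFDerivAt.isLittleO.def (half_pos hε)
  obtain ⟨r, hr, hb⟩ := Metric.eventually_nhds_iff.1 h1
  set s := r / 2 with hs
  have hs0 : 0 < s := half_pos hr
  refine ⟨(fun y => s⁻¹ • (y - F x)) '' (F '' closedBall x s), ?_, ?_⟩
  · refine TotallyBounded.image ((hF _ isBounded_closedBall).totallyBounded.subset subset_closure)
      (f := fun y => s⁻¹ • (y - F x)) ?_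
    exact (uniformContinuous_id.sub uniformContinuous_const).const_smul _
  · rintro _ ⟨v, hv, rfl⟩
    rw [mem_closedBall_zero_iff] at hv
    refine ⟨_, ⟨_, ⟨x + s • v, ?_, rfl⟩, rfl⟩, ?_⟩
    · rw [mem_closedBall, dist_eq_norm, add_sub_cancel_left, norm_smul, Real.norm_of_nonneg hs0.le]
      nlinarith
    · have h2 := hb (y := x + s • v) (by
        rw [dist_eq_norm, add_sub_cancel_left, norm_smul, Real.norm_of_nonneg hs0.le]
        nlinarith)
      rw [add_sub_cancel_left, map_smul, norm_smul, Real.norm_of_nonneg hs0.le] at h2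
      rw [dist_eq_norm]
      have h3 : fderiv ℝ F x v - s⁻¹ • (F (x + s • v) - F x) =
          -(s⁻¹ • (F (x + s • v) - F x - s • fderiv ℝ F x v)) := by
        rw [smul_sub s⁻¹ (F (x + s • v) - F x), smul_smul, inv_mul_cancel₀ hs0.ne',
          one_smul, neg_sub]
      rw [h3, norm_neg, norm_smul, Real.norm_of_nonneg (by positivity)]
      have h4 : s⁻¹ * ‖F (x + s • v) - F x - s • fderiv ℝ F x v‖ ≤ s⁻¹ * (ε / 2 * (s * ‖v‖)) := by
        gcongr
      have h5 : s⁻¹ * (ε / 2 * (s * ‖v‖)) = ε / 2 * ‖v‖ := by field_simp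
      nlinarith

variable {C : Set X} {e : X} {φ : X →L[ℝ] ℝ} {c : ℝ}

lemma exists_isHarnackFamily [CompleteSpace X] (hC : IsUnitCone C e φ c) {𝓑 : Set (X →L[ℝ] X)}
    (h𝓑 : IsCompact 𝓑) (hcpt : ∀ B ∈ 𝓑, IsCompactOperator B)
    (hpos : ∀ B ∈ 𝓑, StronglyPositive C B) : ∃ a L, IsHarnackFamily C e 𝓑 a L := by
  have he0 : e ≠ 0 := fun h => by simpa [h] using hC.map_unit
  have hposC : ∀ B ∈ 𝓑, ∀ x ∈ C, B x ∈ C := by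
    intro B hB x hx
    rcases eq_or_ne x 0 with rfl | hx0
    · simpa using hC.zero_mem
    · exact interior_subset (hpos B hB x ⟨hx, hx0⟩)
  obtain ⟨L₀, hL₀⟩ := h𝓑.isBounded.exists_norm_le
  set L := max 1 L₀
  have hL1 : 1 ≤ L := le_max_left _ _
  have hL : ∀ B ∈ 𝓑, ‖B‖ ≤ L := fun B hB => (hL₀ B hB).trans (le_max_right _ _)
  obtain ⟨δ, hδ, hδe⟩ := exists_sub_smul_mem_of_isCompact (D := (fun B : X →L[ℝ] X => B e) '' 𝓑)
    (h𝓑.image (by fun_prop)) (by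
      rintro _ ⟨B, hB, rfl⟩
      exact hpos B hB e ⟨hC.mem_e, he0⟩) e
  refine ⟨min δ 1, L, lt_min hδ one_pos, min_le_right _ _, hL1, hposC, ?_, hL, ?_⟩
  · intro B hB
    have := hC.add_mem _ (hδe _ ⟨B, hB, rfl⟩) _ (hC.smul_mem (δ - min δ 1)
      (sub_nonneg.2 (min_le_left _ _)) e hC.mem_e)
    convert this using 1
    module
  · intro η hη
    set S : Set X := {w | ∃ B ∈ 𝓑, ∃ z : X, ‖z‖ ≤ 1 ∧ B z = w}
    have hS : TotallyBounded S := by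
      refine totallyBounded_of_forall_exists_dist_lt fun ε hε => ?_
      obtain ⟨t, ht𝓑, ht, hcov⟩ := h𝓑.finite_cover_balls hε
      refine ⟨⋃ B ∈ t, B '' closedBall (0 : X) 1, ?_, ?_⟩
      · rw [totallyBounded_biUnion ht]
        intro B hB
        exact ((hcpt B (ht𝓑 hB)).isCompact_closure_image_closedBall
          (f := (B : X →ₗ[ℝ] X)) 1).totallyBounded.subset subset_closure
      · rintro _ ⟨B, hB, z, hz, rfl⟩
        obtain ⟨B', hB', hd⟩ := mem_iUnion₂.1 (hcov hB)
        refine ⟨B' z, mem_iUnion₂.2 ⟨B', hB', z, by simpa using hz, rfl⟩, ?_⟩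
        rw [mem_ball, dist_eq_norm] at hd
        rw [dist_eq_norm]
        calc ‖B z - B' z‖ = ‖(B - B') z‖ := by simp
          _ ≤ ‖B - B'‖ * ‖z‖ := (B - B').le_opNorm z
          _ ≤ ‖B - B'‖ * 1 := by gcongr
          _ < ε := by simpa using hd
    set D : Set X := closure S ∩ (C ∩ {w | η ≤ ‖w‖})
    have hD : IsCompact D := (hS.closure.isCompact_of_isClosed isClosed_closure).inter_right
      (hC.isClosed.inter (isClosed_le continuous_const continuous_norm))
    obtain ⟨δ, hδ, hδD⟩ := exists_sub_smul_mem_of_isCompact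
      (D := (fun p : (X →L[ℝ] X) × X => p.1 p.2) '' (𝓑 ×ˢ D))
      ((h𝓑.prod hD).image (by fun_prop)) (by
        rintro _ ⟨⟨B, w⟩, ⟨hB, -, hw, hw'⟩, rfl⟩
        refine hpos B hB w ⟨hw, ?_⟩
        rintro rfl
        simp only [mem_ofPred_eq, norm_zero] at hw'
        linarith) e
    refine ⟨δ / L, by positivity, fun B hB B' hB' z hz hle => ?_⟩
    rcases eq_or_ne z 0 with rfl | hz0
    · simpa using hC.zero_mem
    have hz' : 0 < ‖z‖ := norm_pos_iff.2 hz0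
    have hw : B (‖z‖⁻¹ • z) ∈ D := by
      refine ⟨subset_closure ⟨B, hB, _, ?_, rfl⟩,
        hposC B hB _ (hC.smul_mem _ (by positivity) z hz), ?_⟩
      · rw [norm_smul, norm_inv, norm_norm, inv_mul_cancel₀ hz'.ne']
      · simp only [mem_ofPred_eq, map_smul]
        rw [norm_smul, norm_inv, norm_norm, inv_mul_eq_div, le_div_iff₀ hz']
        exact hle
    have h1 := hC.smul_mem ‖z‖ hz'.le _ (hδD _ ⟨(B', _), ⟨hB', hw⟩, rfl⟩)
    have h2 : δ / L * ‖B z‖ ≤ ‖z‖ * δ := by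
      have := (B.le_opNorm z).trans (mul_le_mul_of_nonneg_right (hL B hB) hz'.le)
      rw [div_mul_eq_mul_div, div_le_iff₀ (by linarith)]
      nlinarith
    have h3 := hC.add_mem _ h1 _ (hC.smul_mem (‖z‖ * δ - δ / L * ‖B z‖) (by linarith) e hC.mem_e)
    convert h3 using 1
    simp only [map_smul, smul_sub, smul_smul, mul_inv_cancel₀ hz'.ne', one_smul]
    module

end CompactOperators

section Averages

variable {X : Type*} [NormedAddCommGroup X] [NormedSpace ℝ X]

lemma continuous_fderiv_segment {F : X → X} (hF : ContDiff ℝ 1 F) (x y : X) :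
    Continuous fun t : ℝ => fderiv ℝ F (x + t • (y - x)) :=
  (hF.continuous_fderiv one_ne_zero).comp (by fun_prop)

variable [CompleteSpace X]

lemma IsCompact.closure_convexHull_of_complete {K : Set X} (hK : IsCompact K) :
    IsCompact (closure (convexHull ℝ K)) :=
  (totallyBounded_convexHull.2 hK.totallyBounded).closure.isCompact_of_isClosed isClosed_closure

/-- The average of the derivative of `F` along the segment from `x` to `y`. -/
def segmentAverage (F : X → X) (x y : X) : X →L[ℝ] X :=
  ∫ t in (0 : ℝ)..1, fderiv ℝ F (x + t • (y - x))

variable {F : X → X} (hF : ContDiff ℝ 1 F)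
include hF

lemma sub_eq_segmentAverage (x y : X) : F y - F x = segmentAverage F x y (y - x) := by
  have hc := continuous_fderiv_segment hF x y
  rw [segmentAverage, ContinuousLinearMap.intervalIntegral_apply (hc.intervalIntegrable 0 1)]
  have := intervalIntegral.integral_eq_sub_of_hasDerivAt (a := 0) (b := 1)
    (f := fun t : ℝ => F (x + t • (y - x)))
    (f' := fun t : ℝ => fderiv ℝ F (x + t • (y - x)) (y - x)) (by
      intro t _
      have h1 : HasDerivAt (fun t : ℝ => x + t • (y - x)) (y - x) t := by
        simpa using ((hasDerivAt_id t).smul_const (y - x)).const_add x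
      exact ((hF.differentiable one_ne_zero _).hasFDerivAt.comp_hasDerivAt t h1))
    ((hc.clm_apply continuous_const).intervalIntegrable 0 1)
  rw [this]
  simp

lemma segmentAverage_mem {s : Set (X →L[ℝ] X)} (hs : Convex ℝ s) (hsc : IsClosed s) {x y : X}
    (h : ∀ t ∈ Icc (0 : ℝ) 1, fderiv ℝ F (x + t • (y - x)) ∈ s) : segmentAverage F x y ∈ s := by
  rw [segmentAverage, intervalIntegral.integral_of_le zero_le_one]
  have hp : IsProbabilityMeasure (volume.restrict (Ioc (0 : ℝ) 1)) := ⟨by simp⟩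
  refine hs.integral_mem hsc ?_ ?_
  · rw [ae_restrict_iff' measurableSet_Ioc]
    exact ae_of_all _ fun t ht => h t (Ioc_subset_Icc_self ht)
  · exact ((continuous_fderiv_segment hF x y).intervalIntegrable 0 1).1

variable {C : Set X} {e : X} {φ : X →L[ℝ] ℝ} {c : ℝ}

/-- On a compact set, derivatives of `F` and their averages over segments lie in a Harnack
family, and the averages are uniformly close to the derivatives. -/
lemma exists_isHarnackFamily_segmentAverage (hC : IsUnitCone C e φ c) (hcpt : IsCompactMap F)
    (hpos : ∀ x, StronglyPositive C (fderiv ℝ F x)) {K : Set X} (hK : IsCompact K) :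
    ∃ (𝓑 : Set (X →L[ℝ] X)) (a L : ℝ), IsHarnackFamily C e 𝓑 a L ∧
      (∀ x ∈ K, fderiv ℝ F x ∈ 𝓑) ∧ (∀ x ∈ K, ∀ y ∈ K, segmentAverage F x y ∈ 𝓑) ∧
      ∀ ε > 0, ∃ r > 0, ∀ x ∈ K, ∀ y ∈ K, dist x y < r →
        ‖segmentAverage F x y - fderiv ℝ F x‖ ≤ ε := by
  set H := closure (convexHull ℝ K)
  have hH : IsCompact H := hK.closure_convexHull_of_complete
  have hHc : Convex ℝ H := (convex_convexHull ℝ K).closure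
  have hKH : K ⊆ H := (subset_convexHull ℝ K).trans subset_closure
  have hcont := hF.continuous_fderiv one_ne_zero
  have himg : IsCompact (fderiv ℝ F '' H) := hH.image hcont
  set 𝓑 := closure (convexHull ℝ (fderiv ℝ F '' H))
  have h𝓑 : IsCompact 𝓑 := himg.closure_convexHull_of_complete
  have hsub : fderiv ℝ F '' H ⊆ 𝓑 := (subset_convexHull ℝ _).trans subset_closure
  have h𝓑c : Convex ℝ 𝓑 := (convex_convexHull ℝ _).closure
  have hmin : ∀ s : Set (X →L[ℝ] X), Convex ℝ s → IsClosed s → fderiv ℝ F '' H ⊆ s → 𝓑 ⊆ s :=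
    fun s h1 h2 h3 => closure_minimal (convexHull_min h3 h1) h2
  have hseg : ∀ x ∈ K, ∀ y ∈ K, ∀ t ∈ Icc (0 : ℝ) 1, x + t • (y - x) ∈ H :=
    fun x hx y hy t ht => hHc.add_smul_sub_mem (hKH hx) (hKH hy) ht
  have h𝓑cpt : ∀ B ∈ 𝓑, IsCompactOperator B := by
    refine hmin {B | IsCompactOperator B} ?_ isClosed_setOfPred_isCompactOperator ?_
    · exact (compactOperator (RingHom.id ℝ) X X).convex
    · rintro _ ⟨x, -, rfl⟩
      exact hcpt.isCompactOperator_fderiv (hF.differentiable one_ne_zero x)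
  have h𝓑pos : ∀ B ∈ 𝓑, StronglyPositive C B := by
    intro B hB v hv
    obtain ⟨δ, hδ, hδv⟩ := exists_sub_smul_mem_of_isCompact (C := C)
      (D := (fun B : X →L[ℝ] X => B v) '' (fderiv ℝ F '' H))
      (himg.image (by fun_prop)) (by
        rintro _ ⟨_, ⟨x, -, rfl⟩, rfl⟩
        exact hpos x v hv) e
    refine hC.mem_interior hδ (hmin {B | B v - δ • e ∈ C} ?_ ?_ ?_ hB)
    · intro B₁ h1 B₂ h2 s t hs ht hst
      have := hC.add_mem _ (hC.smul_mem s hs _ h1) _ (hC.smul_mem t ht _ h2)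
      have h3 : (s • B₁ + t • B₂) v - δ • e = s • (B₁ v - δ • e) + t • (B₂ v - δ • e) := by
        rw [show s • (B₁ v - δ • e) + t • (B₂ v - δ • e) =
          s • B₁ v + t • B₂ v - (s + t) • δ • e by module, hst, one_smul]
        rfl
      rw [mem_ofPred_eq, h3]
      exact this
    · exact hC.isClosed.preimage (f := fun B : X →L[ℝ] X => B v - δ • e) (by fun_prop)
    · rintro _ hB'
      exact hδv _ ⟨_, hB', rfl⟩
  obtain ⟨a, L, hfam⟩ := exists_isHarnackFamily hC h𝓑 h𝓑cpt h𝓑pos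
  refine ⟨𝓑, a, L, hfam, fun x hx => hsub ⟨x, hKH hx, rfl⟩, fun x hx y hy =>
    segmentAverage_mem hF h𝓑c isClosed_closure fun t ht => hsub ⟨_, hseg x hx y hy t ht, rfl⟩,
    fun ε hε => ?_⟩
  obtain ⟨r, hr, hunif⟩ := Metric.uniformContinuousOn_iff.1
    (hH.uniformContinuousOn_of_continuous hcont.continuousOn) ε hε
  refine ⟨r, hr, fun x hx y hy hxy => ?_⟩
  have := segmentAverage_mem hF (convex_closedBall (fderiv ℝ F x) ε) isClosed_closedBall
    (x := x) (y := y) fun t ht => (hunif _ (hseg x hx y hy t ht) _ (hKH hx) (by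
      rw [dist_eq_norm, add_sub_cancel_left, norm_smul, Real.norm_of_nonneg ht.1]
      rw [dist_comm, dist_eq_norm] at hxy
      nlinarith [norm_nonneg (y - x), ht.2])).le
  simpa [dist_eq_norm] using this

end Averages

section Dynamics

lemma iterate_mem_of_orbit {α : Type*} {F : α → α} {K : Set α} {x : α} (hx : ∀ n, F^[n] x ∈ K)
    (m n : ℕ) : F^[n] (F^[m] x) ∈ K := by
  rw [← Function.iterate_add_apply]
  exact hx _

variable {X : Type*} [NormedAddCommGroup X] [NormedSpace ℝ X]

/-- The derivatives of `F` along the orbit of `x`. -/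
def derivSeq (F : X → X) (x : X) (i : ℕ) : X →L[ℝ] X := fderiv ℝ F (F^[i] x)

lemma derivSeq_add (F : X → X) (x : X) (m : ℕ) :
    (fun i => derivSeq F x (m + i)) = derivSeq F (F^[m] x) := by
  ext i : 1
  rw [derivSeq, derivSeq, add_comm, Function.iterate_add_apply]

lemma hasFDerivAt_iterate_prodSeq {F : X → X} (hF : Differentiable ℝ F) (n : ℕ) (x : X) :
    HasFDerivAt F^[n] (prodSeq (derivSeq F x) n) x := by
  induction n generalizing x with
  | zero => exact hasFDerivAt_id x
  | succ n ih =>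
    have h1 := (ih (F x)).comp x (hF x).hasFDerivAt
    have h2 : derivSeq F (F x) = fun i => derivSeq F x (i + 1) := by
      have := derivSeq_add F x 1
      simp only [Function.iterate_one] at this
      rw [← this]
      simp only [add_comm]
    rw [h2] at h1
    exact h1

lemma fderiv_iterate_eq_prodSeq {F : X → X} (hF : Differentiable ℝ F) (n : ℕ) (x : X) :
    fderiv ℝ F^[n] x = prodSeq (derivSeq F x) n :=
  (hasFDerivAt_iterate_prodSeq hF n x).fderiv

/-- A compact `C¹` map all of whose derivatives, and their averages over segments, at points of
a compact set `K`, lie in a Harnack family. -/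
structure IsHarnackMap (C : Set X) (e : X) (φ : X →L[ℝ] ℝ) (c : ℝ) (F : X → X) (K : Set X)
    (𝓑 : Set (X →L[ℝ] X)) (a L : ℝ) : Prop where
  cone : IsUnitCone C e φ c
  contDiff : ContDiff ℝ 1 F
  compactMap : IsCompactMap F
  isCompact : IsCompact K
  family : IsHarnackFamily C e 𝓑 a L
  fderiv_mem : ∀ x ∈ K, fderiv ℝ F x ∈ 𝓑
  average_mem : ∀ x ∈ K, ∀ y ∈ K, segmentAverage F x y ∈ 𝓑
  close : ∀ ε > 0, ∃ r > 0, ∀ x ∈ K, ∀ y ∈ K, dist x y < r →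
    ‖segmentAverage F x y - fderiv ℝ F x‖ ≤ ε

variable {C : Set X} {e : X} {φ : X →L[ℝ] ℝ} {c : ℝ}

lemma IsUnitCone.exists_tendsto_of_monotone (hC : IsUnitCone C e φ c) {K : Set X}
    (hK : IsCompact K) {u : ℕ → X} (hu : ∀ i, u i ∈ K) (hmono : ∀ i, u (i + 1) - u i ∈ C) :
    ∃ z, Tendsto u atTop (𝓝 z) := by
  have hle : ∀ i j, u (i + j) - u i ∈ C := by
    intro i j
    induction j with
    | zero => simpa using hC.zero_mem
    | succ j ih =>
      have := hC.add_mem _ (hmono (i + j)) _ ih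
      rwa [sub_add_sub_cancel] at this
  have hcl : ∀ w, MapClusterPt w atTop u → ∀ i, w - u i ∈ C := by
    intro w hw i
    refine IsClosed.mem_of_mapClusterPt (s := {x | x - u i ∈ C})
      (hC.isClosed.preimage (f := fun x => x - u i) (by fun_prop)) hw ?_
    filter_upwards [eventually_ge_atTop i] with j hj
    obtain ⟨l, rfl⟩ := Nat.exists_eq_add_of_le hj
    exact hle i l
  have hcl' : ∀ w z, MapClusterPt w atTop u → MapClusterPt z atTop u → w - z ∈ C := by
    intro w z hw hz
    refine IsClosed.mem_of_mapClusterPt (s := {x | w - x ∈ C})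
      (hC.isClosed.preimage (f := fun x => w - x) (by fun_prop)) hz ?_
    exact Eventually.of_forall fun i => hcl w hw i
  obtain ⟨z, -, hz⟩ := hK.exists_mapClusterPt (u := u) (f := atTop)
    (tendsto_principal.2 (Eventually.of_forall hu))
  refine ⟨z, hK.tendsto_nhds_of_unique_mapClusterPt (Eventually.of_forall hu) fun w _ hw => ?_⟩
  have := hC.pointed _ (hcl' w z hw hz) (by simpa using hcl' z w hz hw)
  exact sub_eq_zero.1 this

variable {F : X → X} {K : Set X} {𝓑 : Set (X →L[ℝ] X)} {a L : ℝ}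

namespace IsHarnackMap

variable (h : IsHarnackMap C e φ c F K 𝓑 a L)
include h

lemma derivSeq_mem {x : X} (hx : ∀ n, F^[n] x ∈ K) (i : ℕ) : derivSeq F x i ∈ 𝓑 :=
  h.fderiv_mem _ (hx i)

variable [CompleteSpace X]

lemma iterate_sub_eq {x y : X} (n : ℕ) :
    F^[n] y - F^[n] x = prodSeq (fun i => segmentAverage F (F^[i] x) (F^[i] y)) n (y - x) := by
  induction n with
  | zero => simp
  | succ n ih =>
    rw [prodSeq_succ_apply, ← ih, Function.iterate_succ_apply', Function.iterate_succ_apply',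
      sub_eq_segmentAverage h.contDiff]

lemma iterate_sub_mem {x y : X} (hx : ∀ n, F^[n] x ∈ K) (hy : ∀ n, F^[n] y ∈ K)
    (hxy : y - x ∈ C) (n : ℕ) : F^[n] y - F^[n] x ∈ C := by
  rw [h.iterate_sub_eq]
  exact prodSeq_mem h.family (fun i => h.average_mem _ (hx i) _ (hy i)) n hxy

lemma exists_tendsto_of_ordered {x : X} (hx : ∀ n, F^[n] x ∈ K) {k : ℕ} {j : ℕ}
    (hj : F^[j + k] x - F^[j] x ∈ C ∨ -(F^[j + k] x - F^[j] x) ∈ C) :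
    ∃ z, Tendsto (fun i => F^[k * i + j] x) atTop (𝓝 z) := by
  have hstep : ∀ i, F^[k * (i + 1) + j] x = F^[k * i] (F^[j + k] x) := by
    intro i
    rw [← Function.iterate_add_apply]
    congr 1
    ring
  have hstep' : ∀ i, F^[k * i + j] x = F^[k * i] (F^[j] x) := by
    intro i
    rw [← Function.iterate_add_apply]
  rcases hj with hj | hj
  · refine h.cone.exists_tendsto_of_monotone h.isCompact (fun i => hx _) fun i => ?_
    rw [hstep, hstep']
    exact h.iterate_sub_mem (iterate_mem_of_orbit hx _) (iterate_mem_of_orbit hx _) hj _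
  · obtain ⟨z, hz⟩ := h.cone.exists_tendsto_of_monotone (u := fun i => -F^[k * i + j] x)
      h.isCompact.neg (fun i => by simpa using hx _) fun i => by
        rw [hstep, hstep', neg_sub_neg]
        rw [neg_sub] at hj
        exact h.iterate_sub_mem (iterate_mem_of_orbit hx _) (iterate_mem_of_orbit hx _) hj _
    exact ⟨-z, by simpa using hz.neg⟩

/-- If the derivative cocycle grows slowly along the orbit of `x` and `F^[k] x` is close to `x`,
then the orbit of `x` under `F^[k]` converges. -/
lemma exists_closing {θ q K₁ δ M : ℝ} (hθ : 0 < θ) (hq : 1 < q) (hθq : θ * q ^ 2 < 1)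
    (hK₁ : 1 ≤ K₁) (hM : 1 ≤ M)
    (hsep : ∀ B : ℕ → X →L[ℝ] X, (∀ i, B i ∈ 𝓑) → ∀ n : ℕ,
      prodSeq B n e - (δ * φ (prodSeq B n e)) • e ∈ C ∧
      ‖prodSeq B n e‖ ≤ K₁ * φ (prodSeq B n e) ∧
      ∀ d : X, prodSeq B n d ∈ C ∨ -prodSeq B n d ∈ C ∨
        ‖prodSeq B n d‖ ≤ K₁ * θ ^ n * φ (prodSeq B n e) * ‖d‖) :
    ∃ r > 0, ∀ (x : X) (k : ℕ), (∀ n, F^[n] x ∈ K) → 0 < k → dist x (F^[k] x) < r →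
      (∀ j, φ (prodSeq (derivSeq F x) j e) ≤ M * q ^ j) →
      ∃ j z, Tendsto (fun i => F^[k * i + j] x) atTop (𝓝 z) := by
  obtain ⟨ε, hε, hpert⟩ := exists_perturbation_bound h.cone h.family hq
  obtain ⟨r, hr, hclose⟩ := h.close ε hε
  refine ⟨r / (K₁ * M), by positivity, fun x k hx hk hdist hgrow => ?_⟩
  set y := F^[k] x with hy
  by_cases hord : ∃ j, F^[j + k] x - F^[j] x ∈ C ∨ -(F^[j + k] x - F^[j] x) ∈ C
  · obtain ⟨j, hj⟩ := hord
    exact ⟨j, h.exists_tendsto_of_ordered hx hj⟩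
  push Not at hord
  have hy' : ∀ j, F^[j] y = F^[j + k] x := fun j => by
    rw [hy, ← Function.iterate_add_apply]
  have hyK : ∀ j, F^[j] y ∈ K := fun j => by rw [hy']; exact hx _
  have hTm : ∀ i, segmentAverage F (F^[i] x) (F^[i] y) ∈ 𝓑 :=
    fun i => h.average_mem _ (hx i) _ (hyK i)
  rw [lt_div_iff₀ (by positivity), dist_comm, dist_eq_norm] at hdist
  have hbound : ∀ j, ‖F^[j] y - F^[j] x‖ ≤ K₁ * M * ‖y - x‖ * (θ * q ^ 2) ^ j := by
    intro j
    induction j using Nat.strong_induction_on with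
    | _ j ih =>
      have h1 : φ (prodSeq (fun i => segmentAverage F (F^[i] x) (F^[i] y)) j e) ≤
          q ^ j * φ (prodSeq (derivSeq F x) j e) := by
        refine hpert _ _ hTm (h.derivSeq_mem hx) j fun i hi => ?_
        refine hclose _ (hx i) _ (hyK i) ?_
        rw [dist_comm, dist_eq_norm]
        refine (ih i hi).trans_lt ?_
        have : (θ * q ^ 2) ^ i ≤ 1 := pow_le_one₀ (by positivity) hθq.le
        have h3 : K₁ * M * ‖y - x‖ * (θ * q ^ 2) ^ i ≤ K₁ * M * ‖y - x‖ * 1 := by gcongr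
        linarith
      have h2 := (hsep _ hTm j).2.2 (y - x)
      rw [← h.iterate_sub_eq, hy'] at h2
      have h3 := (h2.resolve_left (hord j).1).resolve_left (hord j).2
      rw [hy']
      refine h3.trans ?_
      calc K₁ * θ ^ j * φ (prodSeq (fun i => segmentAverage F (F^[i] x) (F^[i] y)) j e) * ‖y - x‖
          ≤ K₁ * θ ^ j * (q ^ j * (M * q ^ j)) * ‖y - x‖ := by
            have := h1.trans (mul_le_mul_of_nonneg_left (hgrow j) (by positivity))
            gcongr
        _ = _ := by rw [mul_pow, ← pow_mul]; ring
  refine ⟨0, ?_⟩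
  refine cauchySeq_tendsto_of_complete (u := fun i => F^[k * i + 0] x) ?_
  refine cauchySeq_of_le_geometric (θ * q ^ 2) (K₁ * M * ‖y - x‖) hθq fun i => ?_
  have h4 : F^[k * (i + 1) + 0] x = F^[k * i] y := by
    rw [hy']
    rfl
  rw [h4, dist_comm, dist_eq_norm, add_zero]
  refine (hbound (k * i)).trans ?_
  have : (θ * q ^ 2) ^ (k * i) ≤ (θ * q ^ 2) ^ i :=
    pow_le_pow_of_le_one (by positivity) hθq.le (Nat.le_mul_of_pos_left i hk)
  gcongr

end IsHarnackMap

end Dynamics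

section Stability

variable {X : Type*} [NormedAddCommGroup X] [NormedSpace ℝ X]
  {C : Set X} {e : X} {φ : X →L[ℝ] ℝ} {c : ℝ} {F : X → X} {K : Set X} {𝓑 : Set (X →L[ℝ] X)}
  {a L : ℝ}

lemma contDiff_iterate (hF : ContDiff ℝ 1 F) (n : ℕ) : ContDiff ℝ 1 F^[n] := by
  induction n with
  | zero => exact contDiff_id
  | succ n ih => exact ih.comp hF

/-- The derivative cocycle along the orbit of `x` grows subexponentially. -/
def HasSlowGrowth (e : X) (φ : X →L[ℝ] ℝ) (F : X → X) (x : X) : Prop :=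
  ∀ r : ℝ, 1 < r → ∃ D : ℝ, ∀ n, φ (prodSeq (derivSeq F x) n e) ≤ D * r ^ n

namespace IsHarnackMap

variable (h : IsHarnackMap C e φ c F K 𝓑 a L)
include h

lemma differentiable : Differentiable ℝ F := h.contDiff.differentiable one_ne_zero

lemma growth_pos {x : X} (hx : ∀ n, F^[n] x ∈ K) (n : ℕ) :
    0 < φ (prodSeq (derivSeq F x) n e) :=
  prodSeq_functional_pos h.cone h.family (h.derivSeq_mem hx) n

lemma exists_growth_mul_le : ∃ δ > 0, ∀ x, (∀ n, F^[n] x ∈ K) → ∀ m n,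
    δ * φ (prodSeq (derivSeq F x) m e) * φ (prodSeq (derivSeq F (F^[m] x)) n e) ≤
      φ (prodSeq (derivSeq F x) (m + n) e) := by
  obtain ⟨_, _, δ, -, -, -, hδ, hsep⟩ := exists_exponential_separation h.cone h.family
  refine ⟨δ, hδ, fun x hx m n => ?_⟩
  have h1 := (hsep _ (h.derivSeq_mem hx) m).1
  have h2 := h.cone.map_nonneg _
    (prodSeq_mem h.family (h.derivSeq_mem (iterate_mem_of_orbit hx m)) n h1)
  rw [map_sub, map_sub, map_smul, map_smul, smul_eq_mul] at h2
  rw [prodSeq_add, derivSeq_add]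
  linarith

/-- Powers of an expanding real eigenvalue of the derivative at a periodic point bound from below
the growth of the order unit. -/
lemma exists_growth_lower_of_eigenvector {z : X} (hz : ∀ n, F^[n] z ∈ K) {k : ℕ}
    (hfix : F^[k] z = z) {w : X} (hw : w ≠ 0) {l : ℝ}
    (hl : l ≠ 0) (heig : fderiv ℝ F^[k] z w = l • w) :
    ∃ η > 0, ∀ i, η * |l| ^ i ≤ φ (prodSeq (derivSeq F z) (k * i) e) := by
  obtain ⟨K₁, _, _, hK₁, -, -, -, hsep⟩ := exists_exponential_separation h.cone h.family
  have hB := h.derivSeq_mem hz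
  have hc := h.cone.c_pos
  have hw0 : 0 < ‖w‖ := norm_pos_iff.2 hw
  have hl0 : 0 < |l| := abs_pos.2 hl
  have hfix' : ∀ i, F^[k * i] z = z := fun i => by
    rw [Function.iterate_mul]
    exact Function.iterate_fixed hfix i
  have hpow : ∀ i, prodSeq (derivSeq F z) (k * i) w = l ^ i • w := by
    intro i
    induction i with
    | zero => simp
    | succ i ih =>
      rw [mul_add, mul_one, prodSeq_add, ih, derivSeq_add, hfix' i, map_smul,
        ← fderiv_iterate_eq_prodSeq h.differentiable, heig, smul_smul, pow_succ]
  by_contra! hcon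
  have hmem : ∀ u : X, (u = w ∨ u = -w) → u ∈ C := by
    intro u hu
    rw [← h.cone.isClosed.closure_eq, Metric.mem_closure_iff]
    intro ε hε
    obtain ⟨i, hi⟩ := hcon (ε / (c * ‖w‖ * K₁)) (by positivity)
    set E := prodSeq (derivSeq F z) (k * i) e
    have hEn : ‖E‖ ≤ K₁ * φ E := (hsep _ hB (k * i)).2.1
    have hli : 0 < |l| ^ i := by positivity
    have hcone : (c * ‖w‖) • E + |l| ^ i • u ∈ C := by
      have h1 := prodSeq_mem h.family hB (k * i) (h.cone.unit w)
      have h2 := prodSeq_mem h.family hB (k * i) (h.cone.unit_sub w)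
      rw [map_add, map_smul, hpow] at h1
      rw [map_sub, map_smul, hpow, sub_eq_add_neg] at h2
      rw [← abs_pow]
      rcases abs_choice (l ^ i) with hs | hs <;> rcases hu with rfl | rfl <;> rw [hs] <;>
        first | simpa using h1 | simpa using h2
    refine ⟨_, h.cone.smul_mem (|l| ^ i)⁻¹ (by positivity) _ hcone, ?_⟩
    rw [smul_add, smul_smul (|l| ^ i)⁻¹ (|l| ^ i), inv_mul_cancel₀ hli.ne', one_smul,
      dist_eq_norm, sub_add_cancel_right, norm_neg, norm_smul, norm_smul,
      Real.norm_of_nonneg (by positivity), Real.norm_of_nonneg (by positivity),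
      inv_mul_lt_iff₀ hli]
    rw [div_mul_eq_mul_div, lt_div_iff₀ (by positivity)] at hi
    calc c * ‖w‖ * ‖E‖ ≤ c * ‖w‖ * (K₁ * φ E) := by gcongr
      _ < |l| ^ i * ε := by linarith
  exact hw (h.cone.pointed w (hmem w (.inl rfl)) (hmem (-w) (.inr rfl)))

variable [CompleteSpace X]

lemma isCompactOperator_fderiv_iterate {k : ℕ} (hk : 0 < k) (x : X) :
    IsCompactOperator (fderiv ℝ F^[k] x) := by
  obtain ⟨k, rfl⟩ := Nat.exists_eq_succ_of_ne_zero hk.ne'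
  rw [fderiv_iterate_eq_prodSeq h.differentiable]
  exact (h.compactMap.isCompactOperator_fderiv (h.differentiable x)).clm_comp
    (prodSeq (fun i => derivSeq F x (i + 1)) k)

/-- Along an orbit with slow growth, limits of periodic subsequences are linearly stable. -/
lemma spectralRadius_le_one {x z : X} (hx : ∀ n, F^[n] x ∈ K) {k J : ℕ} (hk : 0 < k)
    (hz : Tendsto (fun i => F^[k * i + J] x) atTop (𝓝 z)) (hslow : HasSlowGrowth e φ F x) :
    F^[k] z = z ∧ spectralRadius ℝ (fderiv ℝ F^[k] z) ≤ 1 := by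
  have hcont := h.contDiff.continuous
  have hfix : F^[k] z = z := by
    have h1 := ((hcont.iterate k).tendsto z).comp hz
    refine tendsto_nhds_unique h1 (((tendsto_add_atTop_iff_nat 1).2 hz).congr fun i => ?_)
    rw [Function.comp_apply, ← Function.iterate_add_apply]
    congr 1
    ring
  refine ⟨hfix, ?_⟩
  have hzK : ∀ n, F^[n] z ∈ K := fun n =>
    h.isCompact.isClosed.mem_of_tendsto (((hcont.iterate n).tendsto z).comp hz)
      (Eventually.of_forall fun i => iterate_mem_of_orbit hx _ n)
  rw [spectralRadius]
  refine iSup₂_le fun l hl => ?_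
  by_contra! hl1
  have hl1' : 1 < |l| := by exact_mod_cast hl1
  have hl0 : l ≠ 0 := by rintro rfl; norm_num at hl1'
  obtain ⟨w, hw⟩ := (((h.isCompactOperator_fderiv_iterate hk z).hasEigenvalue_iff_mem_spectrum
    hl0).2 hl).exists_hasEigenvector
  obtain ⟨η, hη, hgrow⟩ := h.exists_growth_lower_of_eigenvector hzK hfix hw.2 hl0
    hw.apply_eq_smul
  obtain ⟨_, _, δ, -, -, -, hδ, hsep⟩ := exists_exponential_separation h.cone h.family
  obtain ⟨i₀, hi₀⟩ := pow_unbounded_of_one_lt (2 / (δ * η)) hl1'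
  have h2e : prodSeq (derivSeq F z) (k * i₀) e - (2 : ℝ) • e ∈ C := by
    have h1 := (hsep _ (h.derivSeq_mem hzK) (k * i₀)).1
    have h2 := hgrow i₀
    rw [div_lt_iff₀ (by positivity)] at hi₀
    have h3 : 2 ≤ δ * φ (prodSeq (derivSeq F z) (k * i₀) e) := by nlinarith
    have h4 := h.cone.add_mem _ h1 _ (h.cone.smul_mem _ (sub_nonneg.2 h3) e h.cone.mem_e)
    convert h4 using 1
    module
  set N := k * i₀ with hN
  have hc := h.cone.c_pos
  have hder : ∀ᶠ y in 𝓝 z, prodSeq (derivSeq F y) N e - (3 / 2 : ℝ) • e ∈ C := by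
    have hcd : Continuous fun y => fderiv ℝ F^[N] y e :=
      ((contDiff_iterate h.contDiff N).continuous_fderiv one_ne_zero).clm_apply continuous_const
    filter_upwards [Metric.tendsto_nhds.1 (hcd.tendsto z) (1 / (2 * c)) (by positivity)] with y hy
    rw [fderiv_iterate_eq_prodSeq h.differentiable, fderiv_iterate_eq_prodSeq h.differentiable,
      dist_eq_norm, lt_div_iff₀ (by positivity)] at hy
    set d := prodSeq (derivSeq F y) N e - prodSeq (derivSeq F z) N e
    have h5 := h.cone.add_mem _ (h.cone.add_mem _ h2e _ (h.cone.unit d)) _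
      (h.cone.smul_mem (1 / 2 - c * ‖d‖) (by linarith) e h.cone.mem_e)
    convert h5 using 1
    module
  obtain ⟨i₁, hi₁⟩ := eventually_atTop.1 (hz.eventually hder)
  set y := F^[k * i₁ + J] x with hy
  have hyK : ∀ n, F^[n] y ∈ K := iterate_mem_of_orbit hx _
  have hexp : ∀ l, prodSeq (derivSeq F y) (N * l) e - (3 / 2 : ℝ) ^ l • e ∈ C := by
    intro l
    induction l with
    | zero => simpa using h.cone.zero_mem
    | succ l ih =>
      have h6 := prodSeq_mem h.family (h.derivSeq_mem (iterate_mem_of_orbit hyK (N * l))) N ih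
      have h7 : F^[N * l] y = F^[k * (i₁ + i₀ * l) + J] x := by
        rw [hy, ← Function.iterate_add_apply]
        congr 1
        rw [hN]
        ring
      have h8 := h.cone.smul_mem ((3 / 2 : ℝ) ^ l) (by positivity) _
        (hi₁ (i₁ + i₀ * l) (Nat.le_add_right _ _))
      rw [← h7] at h8
      rw [mul_add, mul_one, prodSeq_add, derivSeq_add]
      have h9 := h.cone.add_mem _ h6 _ h8
      rw [map_sub, map_smul] at h9
      convert h9 using 1
      rw [pow_succ]
      module
  obtain ⟨δ', hδ', hmul⟩ := h.exists_growth_mul_le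
  obtain ⟨r, hr1, hr⟩ : ∃ r : ℝ, 1 < r ∧ r ^ N < 5 / 4 := by
    have h10 : ∀ᶠ r : ℝ in 𝓝[>] 1, r ^ N < 5 / 4 := by
      refine ((continuous_pow N).tendsto (1 : ℝ)).mono_left nhdsWithin_le_nhds
        |>.eventually_lt_const (by norm_num)
    obtain ⟨r, hr, hr'⟩ := (h10.and self_mem_nhdsWithin).exists
    exact ⟨r, hr', hr⟩
  obtain ⟨D, hD⟩ := hslow r hr1
  set M := k * i₁ + J
  set g := φ (prodSeq (derivSeq F x) M e) with hg
  have hgpos : 0 < g := h.growth_pos hx M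
  have hfin : ∀ l : ℕ, (6 / 5 : ℝ) ^ l ≤ D * r ^ M / (δ' * g) := by
    intro l
    have h11 := h.cone.map_nonneg _ (hexp l)
    rw [map_sub, map_smul, smul_eq_mul, h.cone.map_unit, mul_one] at h11
    have h12 := (hmul x hx M (N * l)).trans (hD _)
    have h13 : δ' * g * (3 / 2 : ℝ) ^ l ≤ D * r ^ (M + N * l) :=
      (mul_le_mul_of_nonneg_left (sub_nonneg.1 h11) (by positivity)).trans h12
    have hDr : 0 < D * r ^ M := hgpos.trans_le (hD M)
    have h14 : D * r ^ (M + N * l) ≤ D * r ^ M * (5 / 4) ^ l := by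
      rw [pow_add, pow_mul, ← mul_assoc]
      gcongr
    rw [le_div_iff₀ (by positivity)]
    have h15 : (3 / 2 : ℝ) ^ l = (6 / 5) ^ l * (5 / 4) ^ l := by
      rw [← mul_pow]; norm_num
    have h16 : (0 : ℝ) < (5 / 4) ^ l := by positivity
    rw [h15] at h13
    refine le_of_mul_le_mul_right ?_ h16
    linarith
  obtain ⟨l, hl⟩ := pow_unbounded_of_one_lt (D * r ^ M / (δ' * g)) (by norm_num : (1 : ℝ) < 6 / 5)
  exact absurd (hfin l) (not_le.2 hl)

/-- Orbits with slow growth converge to linearly stable cycles of uniformly bounded period. -/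
theorem exists_uniform_period : ∃ m : ℕ, 0 < m ∧ ∀ x, (∀ n, F^[n] x ∈ K) →
    HasSlowGrowth e φ F x → ∃ k, 0 < k ∧ k ≤ m ∧ ∃ J z,
      Tendsto (fun i => F^[k * i + J] x) atTop (𝓝 z) ∧ F^[k] z = z ∧
        spectralRadius ℝ (fderiv ℝ F^[k] z) ≤ 1 := by
  classical
  obtain ⟨K₁, θ, _, hK₁, hθ, hθ1, -, hsep⟩ := exists_exponential_separation h.cone h.family
  obtain ⟨δ, hδ, hmul⟩ := h.exists_growth_mul_le
  obtain ⟨q, hq1, hq⟩ : ∃ q : ℝ, 1 < q ∧ θ * q ^ 2 < 1 := by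
    have h1 : ∀ᶠ q : ℝ in 𝓝[>] 1, θ * q ^ 2 < 1 := by
      have hc : Continuous fun q : ℝ => θ * q ^ 2 := by fun_prop
      refine (hc.tendsto (1 : ℝ)).mono_left nhdsWithin_le_nhds
        |>.eventually_lt_const (by simpa using hθ1)
    obtain ⟨q, hq, hq'⟩ := (h1.and self_mem_nhdsWithin).exists
    exact ⟨q, hq', hq⟩
  obtain ⟨r, hr, hclosing⟩ := h.exists_closing (M := max 1 (1 / δ)) hθ hq1 hq hK₁
    (le_max_left _ _) hsep
  obtain ⟨N, hN⟩ := h.isCompact.exists_dist_lt_of_card_lt hr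
  obtain ⟨m, hm, hwin⟩ := exists_window_slow_growth (a := δ * a) (mul_pos hδ h.family.a_pos) hq1 N
  refine ⟨m, hm, fun x hx hslow => ?_⟩
  have hg := h.growth_pos hx
  obtain ⟨t, ht⟩ := hwin (fun n => φ (prodSeq (derivSeq F x) n e)) hg (fun n => by
    refine le_trans ?_ (hmul x hx n 1)
    have h1 := prodSeq_functional_lower h.cone h.family
      (h.derivSeq_mem (iterate_mem_of_orbit hx n)) 1
    rw [pow_one] at h1
    have h2 := mul_le_mul_of_nonneg_left h1 (mul_pos hδ (hg n)).le
    linarith) hslow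
  obtain ⟨i, hi, j, hj, hij, hdist⟩ := hN _ (fun i => F^[t + i] x) (fun i _ => hx _) ht
  rw [Finset.mem_filter, Finset.mem_range] at hi hj
  have hij' : F^[j - i] (F^[t + i] x) = F^[t + j] x := by
    rw [← Function.iterate_add_apply]
    congr 1
    omega
  obtain ⟨J, z, hz⟩ := hclosing (F^[t + i] x) (j - i) (iterate_mem_of_orbit hx _) (by omega)
    (by rwa [hij']) fun l => by
      have h1 := (hmul x hx (t + i) l).trans (hi.2 l)
      have h2 : δ * φ (prodSeq (derivSeq F (F^[t + i] x)) l e) ≤ q ^ l := by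
        refine le_of_mul_le_mul_right ?_ (hg (t + i))
        linarith
      have h3 : φ (prodSeq (derivSeq F (F^[t + i] x)) l e) ≤ 1 / δ * q ^ l := by
        rw [div_mul_eq_mul_div, one_mul, le_div_iff₀ hδ]
        linarith
      refine h3.trans ?_
      gcongr
      exact le_max_right _ _
  have hz' : Tendsto (fun l => F^[(j - i) * l + (J + (t + i))] x) atTop (𝓝 z) :=
    hz.congr fun l => by rw [← Function.iterate_add_apply, add_assoc]
  exact ⟨j - i, by omega, by omega, J + (t + i), z, hz',
    h.spectralRadius_le_one hx (by omega) hz' hslow⟩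

end IsHarnackMap

end Stability

section Cycles

variable {X : Type*} [NormedAddCommGroup X]

lemma mem_omegaMap_of_mapClusterPt {F : X → X} {x y : X}
    (hy : MapClusterPt y atTop fun n => F^[n] x) : y ∈ omegaMap F x := by
  refine mem_iInter.2 fun k => isClosed_closure.mem_of_mapClusterPt hy ?_
  filter_upwards [eventually_ge_atTop k] with n hn
  exact subset_closure ⟨n, hn, rfl⟩

lemma finite_orbit_of_iterate_eq {α : Type*} {F : α → α} {z : α} {k : ℕ}
    (hk : 0 < k) (hz : F^[k] z = z) :
    {y : α | ∃ n : ℕ, y = F^[n] z}.Finite := by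
  refine ((finite_Iio k).image fun r => F^[r] z).subset ?_
  rintro _ ⟨n, rfl⟩
  refine ⟨n % k, Nat.mod_lt _ hk, ?_⟩
  exact Function.IsPeriodicPt.iterate_mod_apply (f := F) hz n

lemma omegaMap_eq_orbit {F : X → X} (hF : Continuous F) {x z : X} {k J : ℕ} (hk : 0 < k)
    (hz : F^[k] z = z) (hlim : Tendsto (fun i => F^[k * i + J] x) atTop (𝓝 z)) :
    omegaMap F x = {y : X | ∃ n : ℕ, y = F^[n] z} := by
  have hlim' : ∀ r, Tendsto (fun i => F^[k * i + J + r] x) atTop (𝓝 (F^[r] z)) := fun r =>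
    (((hF.iterate r).tendsto z).comp hlim).congr fun i => by
      rw [Function.comp_apply, ← Function.iterate_add_apply, add_comm]
  have hge : ∀ i r, i ≤ k * i + J + r := fun i r => by
    have := Nat.le_mul_of_pos_left i hk
    omega
  refine Subset.antisymm (fun y hy => ?_) ?_
  · rw [← (finite_orbit_of_iterate_eq hk hz).isClosed.closure_eq, Metric.mem_closure_iff]
    intro ε hε
    have h1 : ∀ᶠ i in atTop, ∀ r ∈ Iio k, dist (F^[k * i + J + r] x) (F^[r] z) < ε / 2 :=
      (eventually_all_finite (finite_Iio k)).2 fun r _ =>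
        Metric.tendsto_nhds.1 (hlim' r) _ (half_pos hε)
    obtain ⟨i₀, hi₀⟩ := eventually_atTop.1 h1
    obtain ⟨_, ⟨n, hn, rfl⟩, hd⟩ := Metric.mem_closure_iff.1
      (mem_iInter.1 hy (k * i₀ + J)) (ε / 2) (half_pos hε)
    refine ⟨_, ⟨(n - J) % k, rfl⟩, ?_⟩
    have hdiv : k * i₀ ≤ n - J := by omega
    have h2 := hi₀ ((n - J) / k) ((Nat.le_div_iff_mul_le hk).2 (by rwa [mul_comm]))
      ((n - J) % k) (Nat.mod_lt _ hk)
    have h3 : k * ((n - J) / k) + J + (n - J) % k = n := by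
      have := Nat.div_add_mod (n - J) k
      omega
    rw [h3] at h2
    linarith [dist_triangle y (F^[n] x) (F^[(n - J) % k] z)]
  · rintro _ ⟨r, rfl⟩
    refine mem_iInter.2 fun m => mem_closure_of_tendsto (hlim' r) ?_
    filter_upwards [eventually_ge_atTop m] with i hi
    exact ⟨_, hi.trans (hge i r), rfl⟩

lemma exists_tendsto_of_omegaMap_eq_orbit {F : X → X} (hF : Continuous F) {K : Set X}
    (hK : IsCompact K) {x z : X} (hx : ∀ᶠ n in atTop, F^[n] x ∈ K) {p : ℕ} (hp : 0 < p)
    (hz : F^[p] z = z) (hω : omegaMap F x = {y : X | ∃ n : ℕ, y = F^[n] z}) :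
    ∃ r, Tendsto (fun i => F^[p * i + r] x) atTop (𝓝 z) := by
  set S := {y : X | ∃ n : ℕ, y = F^[n] z} with hS
  have hSfin : S.Finite := finite_orbit_of_iterate_eq hp hz
  have hzS : z ∈ S := ⟨0, rfl⟩
  have hnear : ∀ η > 0, ∃ N, ∀ n ≥ N, ∃ w ∈ S, dist (F^[n] x) w < η := by
    intro η hη
    by_contra! hcon
    have hfreq : ∃ᶠ n in atTop, F^[n] x ∈ K \ thickening η S := by
      have : ∃ᶠ n in atTop, F^[n] x ∉ thickening η S := by
        rw [frequently_atTop]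
        intro N
        obtain ⟨n, hn, hw⟩ := hcon N
        refine ⟨n, hn, fun hmem => ?_⟩
        obtain ⟨w, hwS, hd⟩ := mem_thickening_iff.1 hmem
        exact absurd hd (not_lt.2 (hw w hwS))
      exact (this.and_eventually hx).mono fun n hn => ⟨hn.2, hn.1⟩
    obtain ⟨y, hy, hcl⟩ := (hK.diff isOpen_thickening).exists_mapClusterPt_of_frequently hfreq
    refine hy.2 (self_subset_thickening hη S ?_)
    rw [← hω]
    exact mem_omegaMap_of_mapClusterPt hcl
  obtain ⟨ρ, hρ, hiso⟩ : ∃ ρ > 0, ∀ w ∈ S, dist w z < ρ → w = z := by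
    have h1 : (S \ {z})ᶜ ∈ 𝓝 z := (hSfin.sdiff).isClosed.isOpen_compl.mem_nhds (by simp)
    obtain ⟨ρ, hρ, hb⟩ := Metric.mem_nhds_iff.1 h1
    refine ⟨ρ, hρ, fun w hw hd => ?_⟩
    by_contra hne
    exact hb (mem_ball.2 hd) ⟨hw, hne⟩
  obtain ⟨η₀, hη₀, hcont⟩ := Metric.continuousAt_iff.1 ((hF.iterate p).continuousAt (x := z))
    (ρ / 2) (half_pos hρ)
  rw [hz] at hcont
  set η := min η₀ (ρ / 2)
  have hη : 0 < η := lt_min hη₀ (half_pos hρ)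
  obtain ⟨N, hN⟩ := hnear η hη
  have hzω : z ∈ omegaMap F x := hω ▸ hzS
  obtain ⟨_, ⟨n₀, hn₀, rfl⟩, hd₀⟩ := Metric.mem_closure_iff.1 (mem_iInter.1 hzω N) η hη
  have hclose : ∀ i, dist (F^[p * i + n₀] x) z < η := by
    intro i
    induction i with
    | zero => simpa [dist_comm] using hd₀
    | succ i ih =>
      have h1 := hcont (ih.trans_le (min_le_left _ _))
      rw [← Function.iterate_add_apply, show p + (p * i + n₀) = p * (i + 1) + n₀ by ring] at h1
      obtain ⟨w, hw, hd⟩ := hN (p * (i + 1) + n₀) (hn₀.trans (Nat.le_add_left _ _))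
      have h2 : η ≤ ρ / 2 := min_le_right _ _
      have h3 : w = z := hiso w hw (by
        linarith [dist_triangle_left w z (F^[p * (i + 1) + n₀] x)])
      rwa [h3] at hd
  refine ⟨n₀, Metric.tendsto_nhds.2 fun ε hε => ?_⟩
  obtain ⟨N', hN'⟩ := hnear (min ε (ρ / 2)) (lt_min hε (half_pos hρ))
  filter_upwards [eventually_ge_atTop N'] with i hi
  obtain ⟨w, hw, hd⟩ := hN' (p * i + n₀) (by
    have := Nat.le_mul_of_pos_left i hp
    omega)
  have h2 : η ≤ ρ / 2 := min_le_right _ _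
  have h4 := hd.trans_le (min_le_right _ _)
  have h3 : w = z := hiso w hw (by
    linarith [dist_triangle_left w z (F^[p * i + n₀] x), hclose i])
  rw [← h3]
  exact hd.trans_le (min_le_left _ _)

variable [NormedSpace ℝ X]

lemma isLinStableCycleLe_orbit {F : X → X} (hF : Differentiable ℝ F) {z : X} {k m : ℕ}
    (hk : 0 < k) (hkm : k ≤ m) (hz : F^[k] z = z)
    (hr : spectralRadius ℝ (fderiv ℝ F^[k] z) ≤ 1) :
    IsLinStableCycleLe F m {y : X | ∃ n : ℕ, y = F^[n] z} := by
  have hper : Function.IsPeriodicPt F k z := hz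
  set p := Function.minimalPeriod F z with hp
  have hp0 : 0 < p := hper.minimalPeriod_pos hk
  have hpz : F^[p] z = z := Function.isPeriodicPt_minimalPeriod F z
  obtain ⟨s, hs⟩ := hper.minimalPeriod_dvd
  have hs0 : s ≠ 0 := by rintro rfl; omega
  refine ⟨p, hp0, (Nat.le_of_dvd hk ⟨s, hs⟩).trans hkm, z, hpz, fun l hl hlp hlz => ?_, ?_, rfl⟩
  · exact absurd (Function.IsPeriodicPt.minimalPeriod_le hl hlz) (not_le.2 hlp)
  · have hpow : fderiv ℝ F^[k] z = fderiv ℝ F^[p] z ^ s := by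
      rw [hs, Function.iterate_mul]
      exact (((hF.iterate p) z).hasFDerivAt.iterate hpz s).fderiv
    rw [spectralRadius] at hr ⊢
    refine iSup₂_le fun l hl => ?_
    have h1 := (iSup₂_le_iff.1 hr) (l ^ s) (by rw [hpow]; exact spectrum.pow_mem_pow _ _ hl)
    rw [nnnorm_pow] at h1
    have h2 : ‖l‖₊ ^ s ≤ 1 := by exact_mod_cast h1
    exact_mod_cast (pow_le_one_iff hs0).1 h2

lemma isLinStableCycleLe_omegaMap_iff {F : X → X} (hF : ContDiff ℝ 1 F) {K : Set X}
    (hK : IsCompact K) {x : X} (hx : ∀ᶠ n in atTop, F^[n] x ∈ K) (m : ℕ) :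
    IsLinStableCycleLe F m (omegaMap F x) ↔ ∃ p, 0 < p ∧ p ≤ m ∧ ∃ r z,
      Tendsto (fun i => F^[p * i + r] x) atTop (𝓝 z) ∧
        spectralRadius ℝ (fderiv ℝ F^[p] z) ≤ 1 := by
  constructor
  · rintro ⟨p, hp, hpm, z, hz, -, hr, hω⟩
    obtain ⟨r, hlim⟩ := exists_tendsto_of_omegaMap_eq_orbit hF.continuous hK hx hp hz hω
    exact ⟨p, hp, hpm, r, z, hlim, hr⟩
  · rintro ⟨p, hp, hpm, r, z, hlim, hr⟩
    have hz : F^[p] z = z := by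
      refine tendsto_nhds_unique (((hF.continuous.iterate p).tendsto z).comp hlim)
        (((tendsto_add_atTop_iff_nat 1).2 hlim).congr fun i => ?_)
      rw [Function.comp_apply, ← Function.iterate_add_apply]
      congr 1
      ring
    rw [omegaMap_eq_orbit hF.continuous hp hz hlim]
    exact isLinStableCycleLe_orbit (hF.differentiable one_ne_zero) hp hpm hz hr

lemma spectralRadius_le_one_iff (T : X →L[ℝ] X) :
    spectralRadius ℝ T ≤ 1 ↔ ∀ n : ℕ, spectrum ℝ T ⊆ ball 0 (1 + 1 / ((n : ℝ) + 1)) := by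
  rw [spectralRadius, iSup₂_le_iff]
  constructor
  · intro h n l hl
    have h1 : ‖l‖ ≤ 1 := by exact_mod_cast h l hl
    rw [mem_ball_zero_iff]
    have : 0 < 1 / ((n : ℝ) + 1) := by positivity
    linarith
  · intro h l hl
    have h1 : ‖l‖ ≤ 1 := by
      refine le_of_forall_pos_le_add fun ε hε => ?_
      obtain ⟨n, hn⟩ := exists_nat_one_div_lt hε
      have := mem_ball_zero_iff.1 (h n hl)
      linarith
    exact_mod_cast h1

variable [CompleteSpace X] [MeasurableSpace X] [BorelSpace X]

lemma measurableSet_spectralRadius_le_one {F : X → X} (hF : ContDiff ℝ 1 F) (p : ℕ) :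
    MeasurableSet {z : X | spectralRadius ℝ (fderiv ℝ F^[p] z) ≤ 1} := by
  simp only [spectralRadius_le_one_iff, ofPred_forall]
  refine MeasurableSet.iInter fun n => IsOpen.measurableSet ?_
  exact (upperHemicontinuous_iff_isOpen_preimage_Iic.1
    (upperHemicontinuous_spectrum ℝ (X →L[ℝ] X)) _ isOpen_ball).preimage
    ((contDiff_iterate hF p).continuous_fderiv one_ne_zero)

lemma measurableSet_tendsto_stable [SecondCountableTopology X] {F : X → X}
    (hF : ContDiff ℝ 1 F) (p r : ℕ) :
    MeasurableSet {x : X | ∃ z, Tendsto (fun i => F^[p * i + r] x) atTop (𝓝 z) ∧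
      spectralRadius ℝ (fderiv ℝ F^[p] z) ≤ 1} := by
  have hm : ∀ i, StronglyMeasurable fun x => F^[p * i + r] x :=
    fun i => (hF.continuous.iterate _).stronglyMeasurable
  have h1 := (StronglyMeasurable.measurableSet_exists_tendsto (l := atTop) hm).inter
    ((StronglyMeasurable.limUnder (l := atTop) hm).measurable
      (measurableSet_spectralRadius_le_one hF p))
  convert h1 using 1
  ext x
  constructor
  · rintro ⟨z, hz, hr⟩
    refine ⟨⟨z, hz⟩, ?_⟩
    rw [mem_preimage, hz.limUnder_eq]
    exact hr
  · rintro ⟨⟨z, hz⟩, hr⟩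
    rw [mem_preimage, hz.limUnder_eq] at hr
    exact ⟨z, hz, hr⟩

lemma measurableSet_isLinStableCycleLe [SecondCountableTopology X] {F : X → X}
    (hF : ContDiff ℝ 1 F) {K : Set X} (hK : IsCompact K)
    (hx : ∀ x, ∀ᶠ n in atTop, F^[n] x ∈ K) (m : ℕ) :
    MeasurableSet {x : X | IsLinStableCycleLe F m (omegaMap F x)} := by
  simp only [fun x => isLinStableCycleLe_omegaMap_iff hF hK (hx x) m]
  refine MeasurableSet.congr (s := ⋃ p ∈ Icc 1 m, ⋃ r : ℕ, {x : X | ∃ z,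
    Tendsto (fun i => F^[p * i + r] x) atTop (𝓝 z) ∧
      spectralRadius ℝ (fderiv ℝ F^[p] z) ≤ 1})
    (MeasurableSet.biUnion (to_countable _) fun p _ => MeasurableSet.iUnion fun r =>
      measurableSet_tendsto_stable hF p r) ?_
  ext x
  simp [Nat.one_le_iff_ne_zero, Nat.pos_iff_ne_zero, and_assoc]

end Cycles

section SlowGrowth

lemma ae_exists_le_mul_sq {α : Type*} [MeasurableSpace α] {μ : Measure α} {f : ℕ → α → ℝ}
    {M : ℝ} (hf : ∀ n, Measurable (f n))
    (hM : ∀ n, ∫⁻ s, ENNReal.ofReal (f n s) ∂μ ≤ ENNReal.ofReal M) :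
    ∀ᵐ s ∂μ, ∃ D : ℝ, ∀ n : ℕ, f n s ≤ D * ((n : ℝ) + 1) ^ 2 := by
  set w : ℕ → ℝ := fun n => 1 / ((n : ℝ) + 1) ^ 2 with hw
  have hw0 : ∀ n, 0 ≤ w n := fun n => by positivity
  have hsum : Summable w := by
    have := (summable_nat_add_iff 1).2 (Real.summable_one_div_nat_pow.2 one_lt_two)
    simpa [hw] using this
  have hmeas : ∀ n, Measurable fun s => ENNReal.ofReal (w n) * ENNReal.ofReal (f n s) :=
    fun n => (hf n).ennreal_ofReal.const_mul _
  have hint : ∫⁻ s, ∑' n, ENNReal.ofReal (w n) * ENNReal.ofReal (f n s) ∂μ ≠ ⊤ := by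
    rw [lintegral_tsum fun n => (hmeas n).aemeasurable]
    refine ne_top_of_le_ne_top ?_ (ENNReal.tsum_le_tsum fun n =>
      (lintegral_const_mul _ (hf n).ennreal_ofReal).le.trans (mul_le_mul_right (hM n) _))
    rw [ENNReal.tsum_mul_right]
    exact ENNReal.mul_ne_top hsum.tsum_ofReal_ne_top ENNReal.ofReal_ne_top
  filter_upwards [ae_lt_top (Measurable.tsum hmeas) hint] with s hs
  refine ⟨(∑' n, ENNReal.ofReal (w n) * ENNReal.ofReal (f n s)).toReal, fun n => ?_⟩
  have h1 := ENNReal.toReal_mono hs.ne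
    (ENNReal.le_tsum (f := fun n => ENNReal.ofReal (w n) * ENNReal.ofReal (f n s)) n)
  rw [ENNReal.toReal_mul, ENNReal.toReal_ofReal (hw0 n)] at h1
  have h2 : f n s ≤ (ENNReal.ofReal (f n s)).toReal := by
    rw [ENNReal.toReal_ofReal']
    exact le_max_left _ _
  have h3 := mul_le_mul_of_nonneg_right h1 (sq_nonneg ((n : ℝ) + 1))
  have h4 : w n * (ENNReal.ofReal (f n s)).toReal * ((n : ℝ) + 1) ^ 2 =
      (ENNReal.ofReal (f n s)).toReal := by
    rw [hw]
    field_simp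
  linarith

lemma exists_sq_le_mul_pow {r : ℝ} (hr : 1 < r) :
    ∃ B : ℝ, ∀ n : ℕ, ((n : ℝ) + 1) ^ 2 ≤ B * r ^ n := by
  have hr0 : 0 < r := by linarith
  have h1 := (tendsto_pow_const_mul_const_pow_of_abs_lt_one 2 (r := r⁻¹) (by
    rw [abs_of_pos (inv_pos.2 hr0)]
    exact inv_lt_one_of_one_lt₀ hr)).bddAbove_range
  obtain ⟨B, hB⟩ := h1
  refine ⟨B * r, fun n => ?_⟩
  have h2 : ((n + 1 : ℕ) : ℝ) ^ 2 * r⁻¹ ^ (n + 1) ≤ B := hB ⟨n + 1, rfl⟩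
  rw [inv_pow, ← div_eq_mul_inv, div_le_iff₀ (by positivity)] at h2
  push_cast at h2
  calc ((n : ℝ) + 1) ^ 2 ≤ B * r ^ (n + 1) := h2
    _ = B * r * r ^ n := by ring

variable {X : Type*} [NormedAddCommGroup X] [NormedSpace ℝ X]
  {C : Set X} {e : X} {φ : X →L[ℝ] ℝ} {c : ℝ} {F : X → X}

lemma hasSlowGrowth_of_le_mul_sq {x : X} {D : ℝ}
    (h : ∀ n : ℕ, φ (prodSeq (derivSeq F x) n e) ≤ D * ((n : ℝ) + 1) ^ 2) :
    HasSlowGrowth e φ F x := by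
  intro r hr
  obtain ⟨B, hB⟩ := exists_sq_le_mul_pow hr
  refine ⟨|D| * B, fun n => (h n).trans ?_⟩
  calc D * ((n : ℝ) + 1) ^ 2 ≤ |D| * ((n : ℝ) + 1) ^ 2 :=
        mul_le_mul_of_nonneg_right (le_abs_self D) (sq_nonneg _)
    _ ≤ |D| * (B * r ^ n) := mul_le_mul_of_nonneg_left (hB n) (abs_nonneg D)
    _ = |D| * B * r ^ n := by ring

lemma StronglyPositive.map_mem {T : X →L[ℝ] X} (hT : StronglyPositive C T) (h0 : (0 : X) ∈ C)
    {v : X} (hv : v ∈ C) : T v ∈ C := by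
  rcases eq_or_ne v 0 with rfl | hv0
  · simpa using h0
  · exact interior_subset (hT v ⟨hv, hv0⟩)

lemma prodSeq_map_mem {B : ℕ → X →L[ℝ] X} (hB : ∀ i, StronglyPositive C (B i))
    (h0 : (0 : X) ∈ C) (n : ℕ) {v : X} (hv : v ∈ C) : prodSeq B n v ∈ C := by
  induction n with
  | zero => exact hv
  | succ n ih =>
    rw [prodSeq_succ_apply]
    exact (hB n).map_mem h0 ih

lemma IsUnitCone.exists_prodSeq_lower (hC : IsUnitCone C e φ c) {B : ℕ → X →L[ℝ] X}
    (hB : ∀ i, StronglyPositive C (B i)) (n : ℕ) :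
    ∃ δ : ℝ, 0 < δ ∧ prodSeq B n e - δ • e ∈ C := by
  induction n with
  | zero => exact ⟨1, one_pos, by simpa using hC.zero_mem⟩
  | succ n ih =>
    obtain ⟨δ, hδ, hmem⟩ := ih
    have hne : prodSeq B n e ≠ 0 := by
      intro h0
      have h1 := hC.map_nonneg _ hmem
      rw [h0, zero_sub, map_neg, map_smul, hC.map_unit, smul_eq_mul, mul_one] at h1
      linarith
    have hint : prodSeq B (n + 1) e ∈ interior C := by
      rw [prodSeq_succ_apply]
      exact hB n _ ⟨prodSeq_map_mem hB hC.zero_mem n hC.mem_e, hne⟩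
    obtain ⟨δ', hδ', h⟩ := exists_sub_smul_mem_of_isCompact isCompact_singleton
      (singleton_subset_iff.2 hint) e
    exact ⟨δ', hδ', h _ rfl⟩

/-- If the derivative cocycle at `x` grows polynomially after time `N`, then it grows slowly
along the orbit of `F^[N] x`. -/
lemma IsUnitCone.hasSlowGrowth_iterate (hC : IsUnitCone C e φ c)
    (hpos : ∀ x, StronglyPositive C (fderiv ℝ F x)) {x : X} {N : ℕ} {D : ℝ}
    (h : ∀ n : ℕ, φ (prodSeq (derivSeq F x) (N + n) e) ≤ D * ((n : ℝ) + 1) ^ 2) :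
    HasSlowGrowth e φ F (F^[N] x) := by
  obtain ⟨δ, hδ, hlow⟩ := hC.exists_prodSeq_lower (B := derivSeq F x) (fun _ => hpos _) N
  refine hasSlowGrowth_of_le_mul_sq (D := δ⁻¹ * D) fun n => ?_
  have h1 := hC.map_nonneg _ (prodSeq_map_mem (B := derivSeq F (F^[N] x)) (fun _ => hpos _)
    hC.zero_mem n hlow)
  have h2 := h n
  rw [prodSeq_add, derivSeq_add] at h2
  rw [map_sub, map_sub, map_smul, map_smul, smul_eq_mul] at h1
  rw [mul_assoc, ← div_eq_inv_mul, le_div_iff₀ hδ]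
  linarith

lemma lintegral_growth_segment [CompleteSpace X] (hC : IsUnitCone C e φ c)
    (hF : ContDiff ℝ 1 F) (hpos : ∀ x, StronglyPositive C (fderiv ℝ F x)) (x : X) (n : ℕ) :
    ∫⁻ s in Icc (0 : ℝ) 1, ENNReal.ofReal (φ (prodSeq (derivSeq F (x + s • e)) n e)) =
      ENNReal.ofReal (φ (F^[n] (x + e) - F^[n] x)) := by
  have hFn := contDiff_iterate hF n
  have hcont : Continuous fun s : ℝ => φ (prodSeq (derivSeq F (x + s • e)) n e) := by
    simp only [← fderiv_iterate_eq_prodSeq (hF.differentiable one_ne_zero)]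
    exact φ.continuous.comp (((hFn.continuous_fderiv one_ne_zero).comp
      (by fun_prop : Continuous fun s : ℝ => x + s • e)).clm_apply continuous_const)
  rw [← restrict_Ioc_eq_restrict_Icc, ← ofReal_integral_eq_lintegral_ofReal
    ((hcont.intervalIntegrable 0 1).1) (ae_of_all _ fun s => hC.map_nonneg _
      (prodSeq_map_mem (fun _ => hpos _) hC.zero_mem n hC.mem_e)),
    ← intervalIntegral.integral_of_le zero_le_one]
  congr 1
  rw [intervalIntegral.integral_eq_sub_of_hasDerivAt (f := fun s : ℝ => φ (F^[n] (x + s • e)))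
    (fun s _ => ?_) (hcont.intervalIntegrable 0 1)]
  · simp
  · have h1 : HasDerivAt (fun s : ℝ => x + s • e) e s := by
      simpa using ((hasDerivAt_id s).smul_const e).const_add x
    exact φ.hasFDerivAt.comp_hasDerivAt s
      ((hasFDerivAt_iterate_prodSeq (hF.differentiable one_ne_zero) n _).comp_hasDerivAt s h1)

lemma IsUnitCone.ae_hasSlowGrowth [CompleteSpace X] (hC : IsUnitCone C e φ c)
    (hF : ContDiff ℝ 1 F) (hpos : ∀ x, StronglyPositive C (fderiv ℝ F x)) {x : X} {N : ℕ} {M : ℝ}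
    (hM : ∀ n, N ≤ n → φ (F^[n] (x + e) - F^[n] x) ≤ M) :
    ∀ᵐ s ∂volume.restrict (Icc (0 : ℝ) 1), HasSlowGrowth e φ F (F^[N] (x + s • e)) := by
  have hmeas : ∀ n, Measurable fun s : ℝ => φ (prodSeq (derivSeq F (x + s • e)) (N + n) e) := by
    intro n
    simp only [← fderiv_iterate_eq_prodSeq (hF.differentiable one_ne_zero)]
    exact (φ.continuous.comp ((((contDiff_iterate hF (N + n)).continuous_fderiv one_ne_zero).comp
      (by fun_prop : Continuous fun s : ℝ => x + s • e)).clm_apply continuous_const)).measurable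
  filter_upwards [ae_exists_le_mul_sq (M := M) hmeas fun n => by
    rw [lintegral_growth_segment hC hF hpos]
    exact ENNReal.ofReal_le_ofReal (hM _ (Nat.le_add_right N n))] with s hs
  obtain ⟨D, hD⟩ := hs
  exact hC.hasSlowGrowth_iterate hpos hD

end SlowGrowth

section Prevalence

variable {X : Type*} [NormedAddCommGroup X] {F : X → X}

lemma IsAttractor.exists_isCompact_absorbing {A : Set X} (hA : IsAttractor F A)
    (hcpt : IsCompactMap F) :
    ∃ K, IsCompact K ∧ ∀ B, IsBounded B → ∃ N : ℕ, ∀ n, N ≤ n → ∀ x ∈ B, F^[n] x ∈ K := by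
  obtain ⟨hne, hAc, -, hattr, -⟩ := hA
  refine ⟨_, hcpt (thickening 1 A) hAc.isBounded.thickening, fun B hB => ?_⟩
  obtain ⟨N, hN⟩ := hattr B hB 1 one_pos
  refine ⟨N + 1, fun n hn x hx => ?_⟩
  obtain ⟨n, rfl⟩ := Nat.exists_eq_add_of_le' (Nat.one_le_of_lt hn)
  rw [Function.iterate_succ_apply']
  exact subset_closure (mem_image_of_mem F
    ((mem_thickening_iff_infDist_lt hne).2 (hN n (by omega) x hx)))

variable [NormedSpace ℝ X]

lemma isShy_of_forall_ae_segment [MeasurableSpace X] [BorelSpace X] {Q : Set X}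
    (hQ : MeasurableSet Q) (e : X)
    (h : ∀ x, ∀ᵐ s ∂volume.restrict (Icc (0 : ℝ) 1), x + s • e ∈ Q) : IsShy Qᶜ := by
  have hline : Continuous fun s : ℝ => s • e := by fun_prop
  refine ⟨hQ.compl, (volume.restrict (Icc (0 : ℝ) 1)).map fun s => s • e, ?_,
    ⟨(fun s : ℝ => s • e) '' Icc 0 1, isCompact_Icc.image hline, ?_⟩, fun x => ?_⟩
  · rw [Ne, Measure.map_eq_zero_iff hline.aemeasurable, Measure.restrict_eq_zero]
    simp
  · rw [Measure.map_apply hline.measurable (isCompact_Icc.image hline).measurableSet.compl,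
      Measure.restrict_apply' measurableSet_Icc]
    convert measure_empty (μ := volume)
    exact eq_empty_of_forall_notMem fun s ⟨hs, hs'⟩ => hs ⟨s, hs', rfl⟩
  · rw [image_add_left, Measure.map_apply hline.measurable
      (hQ.compl.preimage (measurable_const_add (-x)))]
    exact h (-x)

lemma isLinStableCycleLe_of_subsingleton [Subsingleton X] (F : X → X) (x : X) :
    IsLinStableCycleLe F 1 (omegaMap F x) := by
  have hF : Differentiable ℝ F := by
    rw [Subsingleton.elim F fun _ => 0]
    exact differentiable_const 0
  have hlim : Tendsto (fun i => F^[1 * i + 0] x) atTop (𝓝 x) :=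
    tendsto_const_nhds.congr fun _ => Subsingleton.elim _ _
  rw [omegaMap_eq_orbit hF.continuous one_pos (Subsingleton.elim _ _) hlim]
  refine isLinStableCycleLe_orbit hF one_pos le_rfl (Subsingleton.elim _ _) ?_
  rw [spectrum.SpectralRadius.of_subsingleton]
  exact zero_le_one

end Prevalence

/-- **Improved Prevalent Dynamics**: there is an integer `m > 0` such that the set
`Q₀` of points whose ω-limit set is a linearly stable cycle of minimal period at most
`m` is Borel and prevalent in `X` (its complement is shy). -/
theorem improved_prevalent_dynamics
    {X : Type*} [NormedAddCommGroup X] [NormedSpace ℝ X] [CompleteSpace X]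
    [TopologicalSpace.SeparableSpace X] [MeasurableSpace X] [BorelSpace X]
    (C : Set X) (hC : StronglyOrderedCone C)
    (F₀ : X → X) (hC1 : ContDiff ℝ 1 F₀) (hcpt : IsCompactMap F₀)
    (hpos : ∀ x : X, StronglyPositive C (fderiv ℝ F₀ x))
    (hdiss : PointwiseDissipative F₀)
    (A : Set X) (hA : IsAttractor F₀ A) :
    ∃ m : ℕ, 0 < m ∧
      MeasurableSet {x : X | IsLinStableCycleLe F₀ m (omegaMap F₀ x)} ∧
      IsShy {x : X | IsLinStableCycleLe F₀ m (omegaMap F₀ x)}ᶜ := by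
  have : SecondCountableTopology X := UniformSpace.secondCountable_of_separable X
  obtain ⟨K, hK, habs⟩ := hA.exists_isCompact_absorbing hcpt
  have hev : ∀ x, ∀ᶠ n in atTop, F₀^[n] x ∈ K := fun x => by
    obtain ⟨N, hN⟩ := habs {x} isBounded_singleton
    exact eventually_atTop.2 ⟨N, fun n hn => hN n hn x rfl⟩
  have hmeas := measurableSet_isLinStableCycleLe hC1 hK hev
  rcases subsingleton_or_nontrivial X with hX | hX
  · exact ⟨1, one_pos, hmeas 1, isShy_of_forall_ae_segment (hmeas 1) 0 fun x =>
      ae_of_all _ fun s => isLinStableCycleLe_of_subsingleton F₀ _⟩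
  obtain ⟨e, φ, c, hcone⟩ := hC.exists_isUnitCone
  obtain ⟨𝓑, a, L, hfam, hder, hav, hclose⟩ :=
    exists_isHarnackFamily_segmentAverage hC1 hcone hcpt hpos hK
  have h : IsHarnackMap C e φ c F₀ K 𝓑 a L :=
    ⟨hcone, hC1, hcpt, hK, hfam, hder, hav, hclose⟩
  obtain ⟨m, hm, hper⟩ := h.exists_uniform_period
  refine ⟨m, hm, hmeas m, isShy_of_forall_ae_segment (hmeas m) e fun x => ?_⟩
  have hline : Continuous fun s : ℝ => x + s • e := by fun_prop
  obtain ⟨N, hN⟩ := habs _ ((isCompact_Icc (a := (0 : ℝ)) (b := 1)).image hline).isBounded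
  have hNs : ∀ n, N ≤ n → ∀ s ∈ Icc (0 : ℝ) 1, F₀^[n] (x + s • e) ∈ K :=
    fun n hn s hs => hN n hn _ ⟨s, hs, rfl⟩
  obtain ⟨R, hR⟩ := hK.isBounded.exists_norm_le
  have hM : ∀ n, N ≤ n → φ (F₀^[n] (x + e) - F₀^[n] x) ≤ ‖φ‖ * (R + R) := fun n hn => by
    refine (le_abs_self _).trans ((φ.le_opNorm _).trans ?_)
    gcongr
    refine (norm_sub_le _ _).trans (add_le_add (hR _ ?_) (hR _ ?_))
    · simpa using hNs n hn 1 (by simp)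
    · simpa using hNs n hn 0 (by simp)
  filter_upwards [hcone.ae_hasSlowGrowth hC1 hpos hM, ae_restrict_mem measurableSet_Icc]
    with s hslow hs
  have horbit : ∀ n, F₀^[n] (F₀^[N] (x + s • e)) ∈ K := fun n => by
    rw [← Function.iterate_add_apply]
    exact hNs _ (Nat.le_add_left N n) s hs
  obtain ⟨k, hk, hkm, J, z, hlim, -, hr⟩ := hper _ horbit hslow
  refine (isLinStableCycleLe_omegaMap_iff hC1 hK (hev _) m).2 ⟨k, hk, hkm, J + N, z, ?_, hr⟩
  refine hlim.congr fun i => ?_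
  rw [← Function.iterate_add_apply, add_assoc]

end
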